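/- arXiv:2503.09301 — 4 statements merged into one kernel-verified Lean document; each statement's English description precedes it below -/
import Mathlib

section
/- Let k be a field, P a finite poset, and (C,d) a bounded P-graded chain complex of finite-dimensional k-vector spaces. Given a consistent splitting C^p_n ≅ M^p_n ⊕ B^p_n ⊕ K^p_n at every poset grade p ∈ P and every degree n, there exist a P-graded chain complex (M, d^M) with chain groups M_n = ⊕_{p∈P} M^p_n and strict differential d^M, and a P-filtered contraction (f, g, h) from (C,d) onto (M, d^M); in particular, (M, d^M) is a Conley complex of (C,d). -/
open LinearMap Submodule

/-! ## Gradings of vector spaces -/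

/-- An internal grading of a vector space `V` by an index type `ι`, given by a
system of orthogonal idempotent projections which sum (pointwise, with finite
support) to the identity.  The graded piece at `i` is the range of `proj i`. -/
structure VGrading (k V ι : Type*) [Field k] [AddCommGroup V] [Module k V] where
  proj : ι → V →ₗ[k] V
  proj_idem : ∀ i, proj i ∘ₗ proj i = proj i
  proj_orth : ∀ i j, i ≠ j → proj i ∘ₗ proj j = 0
  proj_finite : ∀ v : V, (Function.support fun i => proj i v).Finite
  proj_total : ∀ v : V, (∑ᶠ i, proj i v) = v

namespace VGrading

variable {k V ι : Type*} [Field k] [AddCommGroup V] [Module k V]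

/-- The graded piece of a grading at index `i`. -/
def piece (G : VGrading k V ι) (i : ι) : Submodule k V := LinearMap.range (G.proj i)

end VGrading

/-- The `(i,j)` component of a linear map between `ι`-graded vector spaces:
include the `j`-th piece, apply `f`, project to the `i`-th piece. -/
def gcomp {k V W ι : Type*} [Field k] [AddCommGroup V] [Module k V]
    [AddCommGroup W] [Module k W]
    (GW : VGrading k W ι) (GV : VGrading k V ι) (f : V →ₗ[k] W) (i j : ι) :
    V →ₗ[k] W :=
  GW.proj i ∘ₗ (f ∘ₗ GV.proj j)

/-! ## Contractions and perturbations -/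

/-- A contraction `(f, g, h)` from the differential `dC` on `V` onto the
differential `dD` on `W`: `f, g` are chain maps, `f ∘ g = 1`,
`g ∘ f = 1 + dC h + h dC`, and the side conditions `f h = 0`, `h g = 0`,
`h h = 0` hold. -/
structure IsContraction {k V W : Type*} [Field k] [AddCommGroup V] [Module k V]
    [AddCommGroup W] [Module k W]
    (dC : V →ₗ[k] V) (dD : W →ₗ[k] W)
    (f : V →ₗ[k] W) (g : W →ₗ[k] V) (h : V →ₗ[k] V) : Prop where
  f_chain : f ∘ₗ dC = dD ∘ₗ f
  g_chain : g ∘ₗ dD = dC ∘ₗ g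
  fg : f ∘ₗ g = LinearMap.id
  gf : g ∘ₗ f = LinearMap.id + dC ∘ₗ h + h ∘ₗ dC
  fh : f ∘ₗ h = 0
  hg : h ∘ₗ g = 0
  hh : h ∘ₗ h = 0

/-- Iterated composition of an endomorphism. -/
def endPow {k V : Type*} [Field k] [AddCommGroup V] [Module k V]
    (f : V →ₗ[k] V) : ℕ → (V →ₗ[k] V)
  | 0 => LinearMap.id
  | n + 1 => f ∘ₗ endPow f n

/-- `S` is the sum `Σ_{n ≥ 0} δ (h δ)^n`, which is well defined whenever
`h δ` is locally nilpotent: on every vector the series is eventually zero and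
`S` is given by the corresponding finite partial sum. -/
def IsPerturbSum {k V : Type*} [Field k] [AddCommGroup V] [Module k V]
    (δ h S : V →ₗ[k] V) : Prop :=
  ∀ v : V, ∃ N : ℕ, (∀ m : ℕ, N ≤ m → endPow (h ∘ₗ δ) m v = 0) ∧
    S v = ∑ i ∈ Finset.range N, (δ ∘ₗ endPow (h ∘ₗ δ) i) v

/-! ## Chain complexes over a field (graded by `ℤ`) -/

/-- A chain complex of `k`-vector spaces, realised internally to a single
carrier `V`: a `ℤ`-grading together with a square-zero differential of
degree `-1`. -/
structure ZCC (k V : Type*) [Field k] [AddCommGroup V] [Module k V] where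
  gr : VGrading k V ℤ
  d : V →ₗ[k] V
  d_sq : d ∘ₗ d = 0
  d_deg : ∀ n : ℤ, ∀ v ∈ gr.piece n, d v ∈ gr.piece (n - 1)

namespace ZCC

variable {k V : Type*} [Field k] [AddCommGroup V] [Module k V]

/-- `n`-cycles. -/
def cycles (C : ZCC k V) (n : ℤ) : Submodule k V := C.gr.piece n ⊓ LinearMap.ker C.d

/-- `n`-boundaries. -/
def bdries (C : ZCC k V) (n : ℤ) : Submodule k V := (C.gr.piece (n + 1)).map C.d

/-- The `n`-th homology `ker d_n / im d_{n+1}`. -/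
abbrev homology (C : ZCC k V) (n : ℤ) :=
  ↥(C.cycles n) ⧸ Submodule.comap (C.cycles n).subtype (C.bdries n)

/-- A chain complex is bounded if only finitely many chain groups are nonzero. -/
def Bounded (C : ZCC k V) : Prop := {n : ℤ | C.gr.proj n ≠ 0}.Finite

end ZCC

/-- A map between `ℤ`-graded spaces has degree `r`. -/
def HasDeg {k V W : Type*} [Field k] [AddCommGroup V] [Module k V]
    [AddCommGroup W] [Module k W]
    (GV : VGrading k V ℤ) (GW : VGrading k W ℤ) (f : V →ₗ[k] W) (r : ℤ) : Prop :=
  ∀ n : ℤ, ∀ v ∈ GV.piece n, f v ∈ GW.piece (n + r)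

/-! ## Based complexes and algebraic Morse theory -/

/-- A based complex: a chain complex whose chain groups are further decomposed
as direct sums indexed by `ι`; `deg : ι → ℤ` records which chain group each
basis index belongs to.  Components of the differential can only drop the
degree by one. -/
structure BasedComplex (k V ι : Type*) [Field k] [AddCommGroup V] [Module k V] where
  gr : VGrading k V ι
  deg : ι → ℤ
  d : V →ₗ[k] V
  d_sq : d ∘ₗ d = 0
  d_comp_deg : ∀ α β : ι, deg β ≠ deg α - 1 → gr.proj β ∘ₗ (d ∘ₗ gr.proj α) = 0

namespace BasedComplex

variable {k V ι : Type*} [Field k] [AddCommGroup V] [Module k V]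

/-- The component `d^{βα} : K^α → K^β` of the differential (as an endomorphism
of the carrier). -/
def dcomp (K : BasedComplex k V ι) (β α : ι) : V →ₗ[k] V :=
  K.gr.proj β ∘ₗ (K.d ∘ₗ K.gr.proj α)

/-- The digraph `G_K`: there is an edge `α → β` whenever `d^{βα} ≠ 0`. -/
def Edge (K : BasedComplex k V ι) (α β : ι) : Prop := K.dcomp β α ≠ 0

/-- The component `d^{βα}` restricts to an isomorphism `K^α → K^β`. -/
def CompIso (K : BasedComplex k V ι) (α β : ι) : Prop :=
  (∀ v ∈ K.gr.piece α, K.dcomp β α v = 0 → v = 0) ∧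
  (K.gr.piece α).map (K.dcomp β α) = K.gr.piece β

/-- The edge relation of the digraph `G^μ_K` obtained from `G_K` by reversing
exactly the edges in `μ`. -/
def MuEdge (K : BasedComplex k V ι) (μ : Set (ι × ι)) (α β : ι) : Prop :=
  (K.Edge α β ∧ (α, β) ∉ μ) ∨ (β, α) ∈ μ

/-- A partial matching on `G_K`: a set of edges, no two of which share a
vertex. -/
def IsPartialMatching (K : BasedComplex k V ι) (μ : Set (ι × ι)) : Prop :=
  (∀ e ∈ μ, K.Edge e.1 e.2) ∧
  ∀ e ∈ μ, ∀ e' ∈ μ, e ≠ e' → e.1 ≠ e'.1 ∧ e.1 ≠ e'.2 ∧ e.2 ≠ e'.1 ∧ e.2 ≠ e'.2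

/-- A Morse matching: a partial matching all of whose matched components are
isomorphisms, together with a well-founded (strict) partial order on each
`I_n` such that any path `α → γ → β` in `G^μ_K` between indices of the same
degree satisfies `β ≺ α`. -/
def IsMorseMatching (K : BasedComplex k V ι) (μ : Set (ι × ι)) : Prop :=
  K.IsPartialMatching μ ∧ (∀ e ∈ μ, K.CompIso e.1 e.2) ∧
  ∃ r : ι → ι → Prop, (∀ a b, r a b → K.deg a = K.deg b) ∧ Transitive r ∧
    WellFounded r ∧
    ∀ α γ β : ι, K.deg β = K.deg α → K.MuEdge μ α γ → K.MuEdge μ γ β → r β α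

/-- A vertex is critical for the matching `μ` if it is incident to no edge
of `μ`. -/
def IsCritical (μ : Set (ι × ι)) (α : ι) : Prop := ∀ e ∈ μ, e.1 ≠ α ∧ e.2 ≠ α

/-- The map `d̃`: the sum of the matched components of the differential. -/
noncomputable def dtilde (K : BasedComplex k V ι) (μ : Set (ι × ι)) : V →ₗ[k] V :=
  ∑ᶠ (e : ι × ι) (_ : e ∈ μ), K.dcomp e.2 e.1

/-- The projection onto the span of the critical pieces. -/
noncomputable def critProj (K : BasedComplex k V ι) (μ : Set (ι × ι)) : V →ₗ[k] V :=
  ∑ᶠ (α : ι) (_ : IsCritical μ α), K.gr.proj α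

/-- The span of the critical pieces, i.e. the chain groups of the Morse
complex `K^{(μ)}`. -/
def critSub (K : BasedComplex k V ι) (μ : Set (ι × ι)) : Submodule k V :=
  ⨆ (α : ι) (_ : IsCritical μ α), K.gr.piece α

/-- `ht` is the map `h̃` associated to the matching: it vanishes on every
piece which is not the target of a matched edge, and on the piece `K^β` with
`(α → β) ∈ μ` it is minus the inverse of `d^{βα}`. -/
def IsHTildeB (K : BasedComplex k V ι) (μ : Set (ι × ι)) (ht : V →ₗ[k] V) : Prop :=
  (∀ c : ι, (¬ ∃ a : ι, (a, c) ∈ μ) → ht ∘ₗ K.gr.proj c = 0) ∧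
  ∀ a b : ι, (a, b) ∈ μ → ∀ v ∈ K.gr.piece b,
    ht v ∈ K.gr.piece a ∧ K.dcomp b a (ht v) = -v

end BasedComplex

/-! ## `P`-graded chain complexes -/

/-- A `P`-graded chain complex: the carrier is graded by `ℤ × P`
(chain degree and poset grade), the differential is square-zero, drops the
chain degree by one and is `P`-filtered: components from grade `q` to grade
`p` vanish unless `p ≤ q`. -/
structure PCC (k V P : Type*) [Field k] [AddCommGroup V] [Module k V]
    [PartialOrder P] where
  gr : VGrading k V (ℤ × P)
  d : V →ₗ[k] V
  d_sq : d ∘ₗ d = 0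
  d_filt : ∀ (n m : ℤ) (p q : P),
    (m = n - 1 ∧ p ≤ q) ∨ gr.proj (m, p) ∘ₗ (d ∘ₗ gr.proj (n, q)) = 0

namespace PCC

variable {k V P : Type*} [Field k] [AddCommGroup V] [Module k V] [PartialOrder P]

/-- The twisted differential `t^{pq}_n : C^q_n → C^p_{n-1}`
(as an endomorphism of the carrier). -/
def tcomp (C : PCC k V P) (n : ℤ) (p q : P) : V →ₗ[k] V :=
  C.gr.proj (n - 1, p) ∘ₗ (C.d ∘ₗ C.gr.proj (n, q))

/-- Only finitely many chain groups are nonzero. -/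
def Bounded (C : PCC k V P) : Prop := {i : ℤ × P | C.gr.proj i ≠ 0}.Finite

/-- Cycles of the relative chain complex `(C^p, t^p)` in degree `n`. -/
def relCycles (C : PCC k V P) (n : ℤ) (p : P) : Submodule k V :=
  LinearMap.range (C.gr.proj (n, p)) ⊓ LinearMap.ker (C.tcomp n p p)

/-- Boundaries of the relative chain complex `(C^p, t^p)` in degree `n`. -/
def relBdries (C : PCC k V P) (n : ℤ) (p : P) : Submodule k V :=
  LinearMap.range (C.tcomp (n + 1) p p)

/-- The relative homology `H_n(C^p, t^p)`. -/
abbrev relHomology (C : PCC k V P) (n : ℤ) (p : P) :=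
  ↥(C.relCycles n p) ⧸ Submodule.comap (C.relCycles n p).subtype (C.relBdries n p)

/-- The diagonal part `d̃ = Σ_p t^p` of the differential. -/
noncomputable def dtilde (C : PCC k V P) : V →ₗ[k] V :=
  ∑ᶠ i : ℤ × P, C.gr.proj (i.1 - 1, i.2) ∘ₗ (C.d ∘ₗ C.gr.proj i)

/-- The strictly off-diagonal part `δ = Σ_{p < q} t^{pq} = d - d̃` of the
differential. -/
noncomputable def delta (C : PCC k V P) : V →ₗ[k] V := C.d - C.dtilde

/-- The sublevel subcomplex `F^p = ⊕_{q ≤ p} C^q`. -/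
def Fle (C : PCC k V P) (p : P) : Submodule k V :=
  ⨆ (i : ℤ × P) (_ : i.2 ≤ p), LinearMap.range (C.gr.proj i)

/-- The strict sublevel subcomplex `F^p̌ = ⊕_{q < p} C^q`. -/
def Flt (C : PCC k V P) (p : P) : Submodule k V :=
  ⨆ (i : ℤ × P) (_ : i.2 < p), LinearMap.range (C.gr.proj i)

/-- The total relative chain group `C^p = ⊕_n C^p_n` at grade `p`. -/
def Cp (C : PCC k V P) (p : P) : Submodule k V :=
  ⨆ n : ℤ, LinearMap.range (C.gr.proj (n, p))

end PCC

/-- A linear map between `(ℤ × P)`-graded spaces is `P`-filtered: its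
components from grade `q` to grade `p` vanish unless `p ≤ q`. -/
def PFilt {k V W P : Type*} [Field k] [AddCommGroup V] [Module k V]
    [AddCommGroup W] [Module k W] [PartialOrder P]
    (GV : VGrading k V (ℤ × P)) (GW : VGrading k W (ℤ × P)) (f : V →ₗ[k] W) : Prop :=
  ∀ (n m : ℤ) (p q : P), ¬ p ≤ q → GW.proj (m, p) ∘ₗ (f ∘ₗ GV.proj (n, q)) = 0

/-- A linear map between `(ℤ × P)`-graded spaces has chain degree `r`. -/
def HasDegZP {k V W P : Type*} [Field k] [AddCommGroup V] [Module k V]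
    [AddCommGroup W] [Module k W] [PartialOrder P]
    (GV : VGrading k V (ℤ × P)) (GW : VGrading k W (ℤ × P)) (f : V →ₗ[k] W)
    (r : ℤ) : Prop :=
  ∀ (n m : ℤ) (p q : P), m ≠ n + r → GW.proj (m, q) ∘ₗ (f ∘ₗ GV.proj (n, p)) = 0

/-- A linear map between `P`-graded spaces is `P`-filtered. -/
def PFilt0 {k V W P : Type*} [Field k] [AddCommGroup V] [Module k V]
    [AddCommGroup W] [Module k W] [PartialOrder P]
    (GW : VGrading k W P) (GV : VGrading k V P) (f : V →ₗ[k] W) : Prop :=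
  ∀ p q : P, ¬ p ≤ q → GW.proj p ∘ₗ (f ∘ₗ GV.proj q) = 0

/-! ## Consistent splittings -/

/-- A consistent splitting of a `P`-graded chain complex: each relative chain
group `C^p_n` is split as an internal direct sum `M^p_n ⊕ B^p_n ⊕ K^p_n`
(recorded by three orthogonal idempotents summing to the grading projection),
where the `B`-summand is the space of relative boundaries `im(t^p_{n+1})`,
the `M`- and `B`-summands together span the relative cycles `ker(t^p_n)`,
and `t^p_n` maps the `K`-summand isomorphically onto `B^p_{n-1}`. -/
structure ConsSplit {k V P : Type*} [Field k] [AddCommGroup V] [Module k V]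
    [PartialOrder P] (C : PCC k V P) where
  piM : ℤ → P → (V →ₗ[k] V)
  piB : ℤ → P → (V →ₗ[k] V)
  piK : ℤ → P → (V →ₗ[k] V)
  sum_eq : ∀ n p, piM n p + piB n p + piK n p = C.gr.proj (n, p)
  idem_M : ∀ n p, piM n p ∘ₗ piM n p = piM n p
  idem_B : ∀ n p, piB n p ∘ₗ piB n p = piB n p
  idem_K : ∀ n p, piK n p ∘ₗ piK n p = piK n p
  orth_MB : ∀ n p, piM n p ∘ₗ piB n p = 0
  orth_BM : ∀ n p, piB n p ∘ₗ piM n p = 0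
  orth_MK : ∀ n p, piM n p ∘ₗ piK n p = 0
  orth_KM : ∀ n p, piK n p ∘ₗ piM n p = 0
  orth_BK : ∀ n p, piB n p ∘ₗ piK n p = 0
  orth_KB : ∀ n p, piK n p ∘ₗ piB n p = 0
  range_B : ∀ n p, LinearMap.range (piB n p) = LinearMap.range (C.tcomp (n + 1) p p)
  ker_split : ∀ n p, LinearMap.range (piM n p) ⊔ LinearMap.range (piB n p)
      = LinearMap.range (C.gr.proj (n, p)) ⊓ LinearMap.ker (C.tcomp n p p)
  K_inj : ∀ n p, ∀ v ∈ LinearMap.range (piK n p), C.tcomp n p p v = 0 → v = 0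
  K_onto : ∀ n p, (LinearMap.range (piK n p)).map (C.tcomp n p p)
      = LinearMap.range (piB (n - 1) p)

namespace ConsSplit

variable {k V P : Type*} [Field k] [AddCommGroup V] [Module k V] [PartialOrder P]
  {C : PCC k V P}

/-- The projection `j_M` onto the total Morse summand `M = ⊕_{n,p} M^p_n`. -/
noncomputable def projM (sp : ConsSplit C) : V →ₗ[k] V := ∑ᶠ i : ℤ × P, sp.piM i.1 i.2

/-- The projection `j_K` onto the total preboundary summand. -/
noncomputable def projK (sp : ConsSplit C) : V →ₗ[k] V := ∑ᶠ i : ℤ × P, sp.piK i.1 i.2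

/-- The total Morse summand `M = ⊕_{n,p} M^p_n` as a submodule; this is the
underlying space of the Conley (Morse) complex. -/
def Msub (sp : ConsSplit C) : Submodule k V := ⨆ i : ℤ × P, LinearMap.range (sp.piM i.1 i.2)

/-- The differential `d̃ = i_B ∘ (⊕_p t^p|_{K^p}) ∘ j_K`. -/
noncomputable def dtildeK (sp : ConsSplit C) : V →ₗ[k] V :=
  ∑ᶠ i : ℤ × P, C.tcomp i.1 i.2 i.2 ∘ₗ sp.piK i.1 i.2

/-- `ht` is the map `h̃ = -i_K ∘ (⊕_p (t^p|_{K^p})^{-1}) ∘ j_B`: it vanishes on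
the `M`- and `K`-summands, and on each `B^p_n` it is minus the inverse of the
isomorphism `t^p_{n+1} : K^p_{n+1} → B^p_n`. -/
def IsHTilde (sp : ConsSplit C) (ht : V →ₗ[k] V) : Prop :=
  (∀ n p, ht ∘ₗ sp.piM n p = 0) ∧ (∀ n p, ht ∘ₗ sp.piK n p = 0) ∧
  ∀ n p, ∀ v ∈ LinearMap.range (sp.piB n p),
    ht v ∈ LinearMap.range (sp.piK (n + 1) p) ∧ C.tcomp (n + 1) p p (ht v) = -v

end ConsSplit

/-! ## Ordered bases, pivots and separating bases -/

/-- `i` is the pivot index of `v` with respect to the coordinate functions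
`coord`: the largest index at which `v` has a nonzero coefficient. -/
def IsPivot {k V : Type*} [Field k] [AddCommGroup V] [Module k V] {m : ℕ}
    (coord : Fin m → V →ₗ[k] k) (v : V) (i : Fin m) : Prop :=
  coord i v ≠ 0 ∧ ∀ j : Fin m, coord j v ≠ 0 → j ≤ i

/-- `A n` is a totally ordered (by the order of `Fin (m n)`) basis of the
`n`-th chain group, with coordinate functionals `coord n`. -/
def IsOrderedBasisData {k V : Type*} [Field k] [AddCommGroup V] [Module k V]
    (C : ZCC k V) (m : ℤ → ℕ) (A : ∀ n : ℤ, Fin (m n) → V)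
    (coord : ∀ n : ℤ, Fin (m n) → V →ₗ[k] k) : Prop :=
  ∀ n : ℤ, (∀ i, A n i ∈ C.gr.piece n) ∧ LinearIndependent k (A n) ∧
    Submodule.span k (Set.range (A n)) = C.gr.piece n ∧
    ∀ v ∈ C.gr.piece n, v = ∑ i : Fin (m n), coord n i v • A n i

/-- `(H, B, Pp)` is a family of separating bases: for each `n`, the triple
`(H n, B n, Pp n)` is a separating basis for the `n`-th chain group with
respect to the ordered basis `A n`. -/
def IsSepSystem {k V : Type*} [Field k] [AddCommGroup V] [Module k V]
    (C : ZCC k V) (m : ℤ → ℕ) (A : ∀ n : ℤ, Fin (m n) → V)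
    (coord : ∀ n : ℤ, Fin (m n) → V →ₗ[k] k) (H B Pp : ℤ → Set V) : Prop :=
  ∀ n : ℤ,
    (H n ⊆ C.gr.piece n) ∧ (B n ⊆ C.gr.piece n) ∧ (Pp n ⊆ C.gr.piece n) ∧
    (H n).Finite ∧ (B n).Finite ∧ (Pp n).Finite ∧
    LinearIndependent k (fun x : ↥(H n) => (x : V)) ∧
    LinearIndependent k (fun x : ↥(B n) => (x : V)) ∧
    LinearIndependent k (fun x : ↥(Pp n) => (x : V)) ∧
    Disjoint (Submodule.span k (H n)) (Submodule.span k (B n)) ∧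
    Disjoint (Submodule.span k (H n) ⊔ Submodule.span k (B n))
      (Submodule.span k (Pp n)) ∧
    (Submodule.span k (H n) ⊔ Submodule.span k (B n) ⊔ Submodule.span k (Pp n)
      = C.gr.piece n) ∧
    Submodule.span k (B n) = C.bdries n ∧
    (Submodule.span k (H n) ⊔ Submodule.span k (B n) = C.cycles n) ∧
    (∀ v ∈ Pp n, C.d v ∈ B (n - 1)) ∧
    (∀ v ∈ H n ∪ Pp n, ∀ b ∈ B n, ∀ i, IsPivot (coord n) b i → coord n i v = 0) ∧
    (∀ z ∈ H n, ∀ i, IsPivot (coord n) z i →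
      ∀ v, ((v ∈ H n ∧ v ≠ z) ∨ v ∈ Pp n) → coord n i v = 0) ∧
    (∀ z ∈ H n, ∀ i, IsPivot (coord n) z i → coord n i z = 1)

/-- The set of basis vectors which are pivots of elements of `H`. -/
def pivotVecs {k V : Type*} [Field k] [AddCommGroup V] [Module k V] {mm : ℕ}
    (coord : Fin mm → V →ₗ[k] k) (A : Fin mm → V) (H : Set V) : Set V :=
  {w : V | ∃ z ∈ H, ∃ i : Fin mm, IsPivot coord z i ∧ w = A i}
/-- The algebraic core of the perturbation lemma: given a contraction for the square-zero element
`t` with idempotent `e` and homotopy `h`, and `d` another square-zero element such that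
`1 - h (d - t)` is invertible, the perturbed data form a contraction for `d`. -/
theorem ring_perturb {E : Type*} [Ring E] {d t h e U W : E}
    (hdd : d * d = 0) (htt : t * t = 0) (hhh : h * h = 0) (heh : e * h = 0) (hhe : h * e = 0)
    (hee : e * e = e) (he : e = 1 + t * h + h * t)
    (hU : U * (1 - h * (d - t)) = 1) (hU' : (1 - h * (d - t)) * U = 1)
    (hW : W = 1 + (d - t) * U * h) :
    (e * W) * (U * e) = e ∧ (U * e) * (e * W) = 1 + d * (U * h) + (U * h) * d ∧
    (e * W) * (U * h) = 0 ∧ (U * h) * (U * e) = 0 ∧ (U * h) * (U * h) = 0 := by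
  obtain ⟨s, rfl⟩ : ∃ s, d = t + s := ⟨d - t, by abel⟩
  simp only [add_sub_cancel_left] at *
  have hU1 : U = 1 + h * s * U := by linear_combination (norm := noncomm_ring) hU'
  have hWU : U * h = h * W := by
    rw [hW]; nth_rewrite 1 [hU1]; noncomm_ring
  have hhU : h * U = h := by
    rw [hU1]; linear_combination (norm := noncomm_ring) hhh * (s * U)
  have hWh : W * h = h := by
    rw [hW]; linear_combination (norm := noncomm_ring) (s * U) * hhh
  have heU : e * U = e := by
    rw [hU1]; linear_combination (norm := noncomm_ring) heh * (s * U)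
  have hW1 : W * (1 - s * h) = 1 := by
    rw [hW]
    linear_combination (norm := noncomm_ring) s * hU * h
  have hW1' : (1 - s * h) * W = 1 := by
    rw [hW]
    linear_combination (norm := noncomm_ring) s * hU' * h
  refine ⟨?_, ?_, ?_, ?_, ?_⟩
  · rw [hW]
    linear_combination (norm := noncomm_ring) heU * e + e * s * U * hhU * e + hee + e * s * U * hhe
  · have hz : (1 - h * s) * (t + s) * h + h * (t + s) * (1 - s * h)
        + (1 - h * s) * (1 - s * h) = e := by
      rw [he]
      linear_combination (norm := noncomm_ring) h * htt * h - h * hdd * h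
    calc U * e * (e * W) = U * e * W := by
          linear_combination (norm := noncomm_ring) U * hee * W
      _ = (U * (1 - h * s)) * (t + s) * (h * W) + (U * h) * (t + s) * ((1 - s * h) * W)
          + (U * (1 - h * s)) * ((1 - s * h) * W) := by rw [← hz]; noncomm_ring
      _ = _ := by rw [hU, hW1', ← hWU]; noncomm_ring
  · rw [hWU]
    linear_combination (norm := noncomm_ring) e * hWh * W + heh * W
  · linear_combination (norm := noncomm_ring) U * hhU * e + U * hhe
  · linear_combination (norm := noncomm_ring) U * hhU * h + U * hhh

namespace VGrading

variable {k V ι : Type*} [Field k] [AddCommGroup V] [Module k V] (G : VGrading k V ι)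

lemma proj_mul_self (i : ι) : (G.proj i * G.proj i : Module.End k V) = G.proj i := G.proj_idem i

lemma proj_mul_of_ne {i j : ι} (h : i ≠ j) : (G.proj i * G.proj j : Module.End k V) = 0 :=
  G.proj_orth i j h

/-- If only finitely many projections are nonzero, they sum to the identity. -/
lemma sum_proj {s : Finset ι} (hs : ∀ i, G.proj i ≠ 0 → i ∈ s) :
    ∑ i ∈ s, G.proj i = (1 : Module.End k V) := by
  ext v
  rw [LinearMap.sum_apply, Module.End.one_apply]
  conv_rhs => rw [← G.proj_total v]
  refine (finsum_eq_sum_of_support_subset _ fun i hi => hs i ?_).symm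
  rintro h
  simp [h] at hi

lemma ext_proj {f g : Module.End k V} (h : ∀ j, f * G.proj j = g * G.proj j) : f = g := by
  ext v
  rw [← G.proj_total v, map_finsum _ (G.proj_finite v), map_finsum _ (G.proj_finite v)]
  exact finsum_congr fun j => LinearMap.congr_fun (h j) v

/-- An endomorphism may be prescribed on each of the finitely many nonzero pieces. -/
lemma exists_mul_proj (hG : {i | G.proj i ≠ 0}.Finite) (a : ι → Module.End k V)
    (ha : ∀ i, a i * G.proj i = a i) : ∃ T : Module.End k V, ∀ i, T * G.proj i = a i := by
  classical
  refine ⟨∑ i ∈ hG.toFinset, a i, fun j => ?_⟩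
  have key : ∀ i, a i * G.proj j = if i = j then a j else 0 := by
    intro i
    split_ifs with hij
    · rw [hij, ha]
    · rw [← ha i, mul_assoc, G.proj_mul_of_ne hij, mul_zero]
  rw [Finset.sum_mul, Finset.sum_congr rfl fun i _ => key i, Finset.sum_ite_eq']
  split_ifs with hj
  · rfl
  · have : G.proj j = 0 := by simpa using hj
    rw [← ha j, this, mul_zero]

/-- The components of `f` from the piece `j` to the piece `i` vanish unless `R i j`. -/
def IsSupported (R : ι → ι → Prop) (f : Module.End k V) : Prop :=
  ∀ i j, ¬ R i j → G.proj i * f * G.proj j = 0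

namespace IsSupported

variable {G} {R S T : ι → ι → Prop} {f g : Module.End k V}

lemma mono (hf : G.IsSupported R f) (h : ∀ i j, R i j → S i j) : G.IsSupported S f :=
  fun i j hij => hf i j fun hR => hij (h i j hR)

lemma add (hf : G.IsSupported R f) (hg : G.IsSupported R g) : G.IsSupported R (f + g) :=
  fun i j hij => by rw [mul_add, add_mul, hf i j hij, hg i j hij, add_zero]

lemma one (h : ∀ i, R i i) : G.IsSupported R (1 : Module.End k V) := by
  intro i j hij
  rw [mul_one, G.proj_mul_of_ne]
  rintro rfl
  exact hij (h i)

lemma mul (hG : {i | G.proj i ≠ 0}.Finite) (hf : G.IsSupported R f) (hg : G.IsSupported S g)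
    (h : ∀ i l j, R i l → S l j → T i j) : G.IsSupported T (f * g) := by
  intro i j hij
  have key : G.proj i * (f * g) * G.proj j =
      ∑ l ∈ hG.toFinset, (G.proj i * f * G.proj l) * (G.proj l * g * G.proj j) := by
    calc G.proj i * (f * g) * G.proj j = G.proj i * f * 1 * g * G.proj j := by noncomm_ring
      _ = ∑ l ∈ hG.toFinset, G.proj i * f * (G.proj l * G.proj l) * g * G.proj j := by
        rw [← G.sum_proj (s := hG.toFinset) (by simp)]
        simp only [Finset.mul_sum, Finset.sum_mul, proj_mul_self]
      _ = _ := Finset.sum_congr rfl fun l _ => by noncomm_ring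
  rw [key]
  refine Finset.sum_eq_zero fun l _ => ?_
  by_cases hR : R i l
  · rw [hg l j fun hS => hij (h i l j hR hS), mul_zero]
  · rw [hf i l hR, zero_mul]

lemma geom_sum (hG : {i | G.proj i ≠ 0}.Finite) (hf : G.IsSupported S f) (h₁ : ∀ i, R i i)
    (h : ∀ i l j, S i l → R l j → R i j) (n : ℕ) :
    G.IsSupported R (∑ i ∈ Finset.range n, f ^ i) := by
  induction n with
  | zero => exact fun i j _ => by simp
  | succ n ih =>
    rw [geom_sum_succ]
    exact (mul hG hf ih h).add (one h₁)

lemma of_mul_proj (φ : ι → ι) (h : ∀ j, f * G.proj j = G.proj (φ j) * f * G.proj j) :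
    G.IsSupported (fun i j => i = φ j) f := by
  intro i j hij
  rw [mul_assoc, h j, ← mul_assoc, ← mul_assoc, G.proj_mul_of_ne hij, zero_mul, zero_mul]

/-- A map all of whose components strictly decrease a rank function with finitely many values
is nilpotent. -/
lemma pow_eq_zero (hG : {i | G.proj i ≠ 0}.Finite) (r : ι → ℕ) {N : ℕ} (hr : ∀ i, r i < N)
    (hf : G.IsSupported (fun i j => r i < r j) f) : f ^ N = 0 := by
  have hpow : ∀ n, G.IsSupported (fun i j => r i + n ≤ r j) (f ^ n) := by
    intro n
    induction n with
    | zero => exact one fun i => by simp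
    | succ n ih =>
      rw [pow_succ]
      exact mul hG ih hf fun i l j h₁ h₂ => by omega
  rw [← one_mul (f ^ N), ← mul_one (1 * f ^ N), ← G.sum_proj (s := hG.toFinset) (by simp)]
  simp only [Finset.mul_sum, Finset.sum_mul]
  refine Finset.sum_eq_zero fun j _ => Finset.sum_eq_zero fun i _ => hpow N _ _ ?_
  have := hr j
  omega

end IsSupported

end VGrading

lemma LinearMap.mul_eq_of_range_le {k V : Type*} [Field k] [AddCommGroup V] [Module k V]
    {p f : Module.End k V} (hp : p * p = p) (h : LinearMap.range f ≤ LinearMap.range p) :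
    p * f = f := by
  ext v
  obtain ⟨w, hw⟩ := h ⟨v, rfl⟩
  rw [Module.End.mul_apply, ← hw]
  exact LinearMap.congr_fun hp w

/-- A linear map that sends the range of one idempotent isomorphically onto the range of another
one, and annihilates the kernel of the former, has a partial inverse. -/
lemma LinearMap.exists_partial_inverse {k V : Type*} [Field k] [AddCommGroup V] [Module k V]
    {t b c : Module.End k V} (hb : b * b = b) (hc : c * c = c) (htc : t * c = t)
    (hinj : ∀ v ∈ LinearMap.range c, t v = 0 → v = 0)
    (honto : LinearMap.range t = LinearMap.range b) :
    ∃ s : Module.End k V, c * s = s ∧ s * b = s ∧ t * s = b ∧ s * t = c := by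
  obtain ⟨r, hr⟩ := t.rangeRestrict.exists_rightInverse_of_surjective t.range_rangeRestrict
  obtain ⟨g, hg⟩ := r.exists_extend
  have htgt : t * g * t = t := by
    ext v
    have h1 : g (t v) = r (t.rangeRestrict v) := LinearMap.congr_fun hg (t.rangeRestrict v)
    have h2 := LinearMap.congr_fun hr (t.rangeRestrict v)
    simpa [h1] using congrArg Subtype.val h2
  have hbt : b * t = t := mul_eq_of_range_le hb honto.le
  have htgb : t * g * b = b := by
    ext v
    obtain ⟨w, hw⟩ := honto.ge ⟨v, rfl⟩
    rw [Module.End.mul_apply, ← hw]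
    exact LinearMap.congr_fun htgt w
  refine ⟨c * g * b, ?_, ?_, ?_, ?_⟩
  · simp only [← mul_assoc, hc]
  · simp only [mul_assoc, hb]
  · simp only [← mul_assoc, htc, htgb]
  · rw [mul_assoc, hbt, ← sub_eq_zero]
    ext v
    refine hinj _ ⟨g (t v) - v, ?_⟩ ?_
    · simp only [map_sub, LinearMap.sub_apply, Module.End.mul_apply]
    · have h1 := LinearMap.congr_fun htc (g (t v))
      have h2 := LinearMap.congr_fun htc v
      have h3 := LinearMap.congr_fun htgt v
      simp only [Module.End.mul_apply] at h1 h2 h3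
      simp [h1, h2, h3]

namespace ConsSplit

variable {k V P : Type*} [Field k] [AddCommGroup V] [Module k V] [PartialOrder P]
  {C : PCC k V P} (sp : ConsSplit C)

lemma piM_mul_piM (n : ℤ) (p : P) : (sp.piM n p * sp.piM n p : Module.End k V) = sp.piM n p :=
  sp.idem_M n p

lemma piB_mul_piB (n : ℤ) (p : P) : (sp.piB n p * sp.piB n p : Module.End k V) = sp.piB n p :=
  sp.idem_B n p

lemma piK_mul_piK (n : ℤ) (p : P) : (sp.piK n p * sp.piK n p : Module.End k V) = sp.piK n p :=
  sp.idem_K n p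

lemma piM_mul_piB (n : ℤ) (p : P) : (sp.piM n p * sp.piB n p : Module.End k V) = 0 :=
  sp.orth_MB n p

lemma piB_mul_piM (n : ℤ) (p : P) : (sp.piB n p * sp.piM n p : Module.End k V) = 0 :=
  sp.orth_BM n p

lemma piM_mul_piK (n : ℤ) (p : P) : (sp.piM n p * sp.piK n p : Module.End k V) = 0 :=
  sp.orth_MK n p

lemma piK_mul_piM (n : ℤ) (p : P) : (sp.piK n p * sp.piM n p : Module.End k V) = 0 :=
  sp.orth_KM n p

lemma piB_mul_piK (n : ℤ) (p : P) : (sp.piB n p * sp.piK n p : Module.End k V) = 0 :=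
  sp.orth_BK n p

lemma piK_mul_piB (n : ℤ) (p : P) : (sp.piK n p * sp.piB n p : Module.End k V) = 0 :=
  sp.orth_KB n p

lemma proj_mul_piM (n : ℤ) (p : P) :
    (C.gr.proj (n, p) * sp.piM n p : Module.End k V) = sp.piM n p := by
  rw [← sp.sum_eq]
  simp only [add_mul, piM_mul_piM, piB_mul_piM, piK_mul_piM, add_zero]

lemma piM_mul_proj (n : ℤ) (p : P) :
    (sp.piM n p * C.gr.proj (n, p) : Module.End k V) = sp.piM n p := by
  rw [← sp.sum_eq]
  simp only [mul_add, piM_mul_piM, piM_mul_piB, piM_mul_piK, add_zero]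

lemma piB_mul_proj (n : ℤ) (p : P) :
    (sp.piB n p * C.gr.proj (n, p) : Module.End k V) = sp.piB n p := by
  rw [← sp.sum_eq]
  simp only [mul_add, piB_mul_piM, piB_mul_piB, piB_mul_piK, add_zero, zero_add]

lemma proj_mul_piK (n : ℤ) (p : P) :
    (C.gr.proj (n, p) * sp.piK n p : Module.End k V) = sp.piK n p := by
  rw [← sp.sum_eq]
  simp only [add_mul, piK_mul_piK, piB_mul_piK, piM_mul_piK, zero_add]

lemma proj_mul_tcomp (n : ℤ) (p : P) :
    (C.gr.proj (n - 1, p) * C.tcomp n p p : Module.End k V) = C.tcomp n p p := by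
  change C.gr.proj (n - 1, p) * (C.gr.proj (n - 1, p) * (C.d * C.gr.proj (n, p))) =
    C.gr.proj (n - 1, p) * (C.d * C.gr.proj (n, p))
  rw [← mul_assoc, VGrading.proj_mul_self]

lemma tcomp_mul_proj (n : ℤ) (p : P) :
    (C.tcomp n p p * C.gr.proj (n, p) : Module.End k V) = C.tcomp n p p := by
  change C.gr.proj (n - 1, p) * (C.d * C.gr.proj (n, p)) * C.gr.proj (n, p) =
    C.gr.proj (n - 1, p) * (C.d * C.gr.proj (n, p))
  rw [mul_assoc, mul_assoc, VGrading.proj_mul_self]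

lemma tcomp_mul_piM (n : ℤ) (p : P) : (C.tcomp n p p * sp.piM n p : Module.End k V) = 0 := by
  ext v
  have h : sp.piM n p v ∈ LinearMap.range (sp.piM n p) ⊔ LinearMap.range (sp.piB n p) :=
    Submodule.mem_sup_left ⟨v, rfl⟩
  rw [sp.ker_split] at h
  exact h.2

lemma tcomp_mul_piB (n : ℤ) (p : P) : (C.tcomp n p p * sp.piB n p : Module.End k V) = 0 := by
  ext v
  have h : sp.piB n p v ∈ LinearMap.range (sp.piM n p) ⊔ LinearMap.range (sp.piB n p) :=
    Submodule.mem_sup_right ⟨v, rfl⟩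
  rw [sp.ker_split] at h
  exact h.2

lemma tcomp_mul_piK (n : ℤ) (p : P) :
    (C.tcomp n p p * sp.piK n p : Module.End k V) = C.tcomp n p p := by
  conv_rhs => rw [← tcomp_mul_proj, ← sp.sum_eq]
  rw [mul_add, mul_add, tcomp_mul_piM, tcomp_mul_piB, zero_add, zero_add]

lemma range_tcomp (n : ℤ) (p : P) :
    LinearMap.range (C.tcomp n p p) = LinearMap.range (sp.piB (n - 1) p) := by
  rw [sp.range_B, sub_add_cancel]

lemma piB_mul_tcomp (n : ℤ) (p : P) :
    (sp.piB (n - 1) p * C.tcomp n p p : Module.End k V) = C.tcomp n p p :=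
  LinearMap.mul_eq_of_range_le (sp.piB_mul_piB _ _) (sp.range_tcomp n p).le

/-- The inverse of `t^p_{n+1} : K^p_{n+1} → B^p_n`, extended by zero. -/
lemma exists_inverse_tcomp (n : ℤ) (p : P) : ∃ s : Module.End k V,
    sp.piK (n + 1) p * s = s ∧ s * sp.piB n p = s ∧ C.tcomp (n + 1) p p * s = sp.piB n p ∧
      s * C.tcomp (n + 1) p p = sp.piK (n + 1) p :=
  LinearMap.exists_partial_inverse (sp.piB_mul_piB n p) (sp.piK_mul_piK _ _)
    (sp.tcomp_mul_piK _ _) (sp.K_inj _ _) (sp.range_B n p).symm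

/-- The contraction of the diagonal part `t` of the differential onto the Morse summand. -/
lemma exists_diagonal_contraction (hbd : C.Bounded) : ∃ t h e : Module.End k V,
    (∀ i : ℤ × P, t * C.gr.proj i = C.tcomp i.1 i.2 i.2) ∧
    (∀ i : ℤ × P, e * C.gr.proj i = sp.piM i.1 i.2) ∧
    (∀ i : ℤ × P, h * C.gr.proj i = C.gr.proj (i.1 + 1, i.2) * h * C.gr.proj i) ∧
    t * t = 0 ∧ h * h = 0 ∧ e * h = 0 ∧ h * e = 0 ∧ e * e = e ∧ t * e = 0 ∧
    e = 1 + t * h + h * t := by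
  choose s hKs hsB hts hst using sp.exists_inverse_tcomp
  obtain ⟨t, ht⟩ := C.gr.exists_mul_proj hbd (fun i => C.tcomp i.1 i.2 i.2)
    fun i => tcomp_mul_proj i.1 i.2
  obtain ⟨e, he⟩ := C.gr.exists_mul_proj hbd (fun i => sp.piM i.1 i.2)
    fun i => sp.piM_mul_proj i.1 i.2
  obtain ⟨h, hh⟩ := C.gr.exists_mul_proj hbd (fun i => -s i.1 i.2) fun i => by
    rw [neg_mul, ← hsB, mul_assoc, sp.piB_mul_proj]
  have hpt (n : ℤ) (p : P) (f : Module.End k V) :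
      f * C.tcomp n p p = f * C.gr.proj (n - 1, p) * C.tcomp n p p := by
    rw [mul_assoc, proj_mul_tcomp]
  have hpM (n : ℤ) (p : P) (f : Module.End k V) :
      f * sp.piM n p = f * C.gr.proj (n, p) * sp.piM n p := by
    rw [mul_assoc, proj_mul_piM]
  have hps (n : ℤ) (p : P) : C.gr.proj (n + 1, p) * s n p = s n p := by
    rw [← hKs, ← mul_assoc, proj_mul_piK]
  have hfs (n : ℤ) (p : P) (f : Module.End k V) :
      f * s n p = f * C.gr.proj (n + 1, p) * s n p := by
    rw [mul_assoc, hps]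
  refine ⟨t, h, e, ht, he, ?_, ?_, ?_, ?_, ?_, ?_, ?_, ?_⟩
  · rintro ⟨n, p⟩
    rw [mul_assoc, hh, mul_neg, hps]
  all_goals
    refine C.gr.ext_proj ?_
    rintro ⟨n, p⟩
  · rw [mul_assoc, ht, hpt, ht, ← piB_mul_tcomp sp n p, ← mul_assoc, tcomp_mul_piB, zero_mul,
      zero_mul]
  · rw [mul_assoc, hh, mul_neg, hfs, hh, ← hKs n p, neg_mul, neg_neg, ← hsB (n + 1) p, mul_assoc,
      ← mul_assoc (sp.piB _ _), piB_mul_piK, zero_mul, mul_zero, zero_mul]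
  · rw [mul_assoc, hh, mul_neg, hfs, he, ← hKs n p, ← mul_assoc, piM_mul_piK, zero_mul, neg_zero,
      zero_mul]
  · rw [mul_assoc, he, hpM, hh, ← hsB n p, neg_mul, mul_assoc, piB_mul_piM, mul_zero, neg_zero,
      zero_mul]
  · rw [mul_assoc, he, hpM, he, piM_mul_piM]
  · rw [mul_assoc, he, hpM, ht, tcomp_mul_piM, zero_mul]
  · have h1 := hst (n - 1) p
    rw [sub_add_cancel] at h1
    rw [add_mul, add_mul, mul_assoc t, mul_assoc h, he, ht, hh, hpt, hh, mul_neg, hfs, ht, hts,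
      neg_mul, h1, one_mul, ← sp.sum_eq]
    abel

lemma mem_Msub_iff {e : Module.End k V} (he : ∀ i : ℤ × P, e * C.gr.proj i = sp.piM i.1 i.2)
    (hee : e * e = e) {v : V} : v ∈ sp.Msub ↔ e v = v := by
  have hrange : sp.Msub = LinearMap.range e := by
    apply le_antisymm
    · refine iSup_le fun i => ?_
      rintro _ ⟨v, rfl⟩
      exact ⟨C.gr.proj i v, LinearMap.congr_fun (he i) v⟩
    · rintro _ ⟨v, rfl⟩
      rw [← C.gr.proj_total v, map_finsum _ (C.gr.proj_finite v)]
      refine finsum_induction (· ∈ sp.Msub) (zero_mem _) (fun _ _ => add_mem) fun i => ?_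
      exact Submodule.mem_iSup_of_mem i ⟨v, (LinearMap.congr_fun (he i) v).symm⟩
  rw [hrange]
  constructor
  · rintro ⟨w, rfl⟩
    exact LinearMap.congr_fun hee w
  · exact fun h => ⟨v, h⟩

/-- The contraction of `d` onto the Morse summand, obtained by perturbing the contraction of its
diagonal part. Maps from and to the Morse summand are expressed as endomorphisms of the carrier. -/
lemma exists_perturbed_contraction [Fintype P] (hbd : C.Bounded) : ∃ e F G H : Module.End k V,
    (∀ v, v ∈ sp.Msub ↔ e v = v) ∧ e * F = F ∧ G * e = G ∧
    F * G = e ∧ G * F = 1 + C.d * H + H * C.d ∧ F * H = 0 ∧ H * G = 0 ∧ H * H = 0 ∧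
    C.gr.IsSupported (fun i j => i.1 = j.1 ∧ i.2 ≤ j.2) F ∧
    C.gr.IsSupported (fun i j => i.1 = j.1 ∧ i.2 ≤ j.2) G ∧
    C.gr.IsSupported (fun i j => i.1 = j.1 + 1 ∧ i.2 ≤ j.2) H ∧
    C.gr.IsSupported (fun i j => i.1 = j.1 - 1 ∧ i.2 < j.2) (F * C.d * G) := by
  classical
  obtain ⟨t, h, e, ht, he, hh, htt, hhh, heh, hhe, hee, hte, heq⟩ :=
    sp.exists_diagonal_contraction hbd
  have hdd : (C.d * C.d : Module.End k V) = 0 := C.d_sq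
  have hδ : C.gr.IsSupported (fun i j => i.1 = j.1 - 1 ∧ i.2 < j.2) (C.d - t) := by
    rintro ⟨m, p⟩ ⟨n, q⟩ hij
    rw [mul_sub, sub_mul, mul_assoc _ t, ht, mul_assoc]
    dsimp only
    by_cases hmn : (m, p) = (n - 1, q)
    · rw [hmn, proj_mul_tcomp]
      exact sub_self _
    · rw [← proj_mul_tcomp, ← mul_assoc _ (C.gr.proj (n - 1, q)), C.gr.proj_mul_of_ne hmn,
        zero_mul, sub_zero]
      refine (C.d_filt n m p q).resolve_left fun hmp => hij ⟨hmp.1, lt_of_le_of_ne hmp.2 ?_⟩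
      rintro rfl
      exact hmn (by rw [hmp.1])
  have hd : C.gr.IsSupported (fun i j => i.1 = j.1 - 1 ∧ i.2 ≤ j.2) C.d :=
    fun i j hij => (C.d_filt j.1 i.1 i.2 j.2).resolve_left hij
  have hhs : C.gr.IsSupported (fun i j => i.1 = j.1 + 1 ∧ i.2 ≤ j.2) h :=
    (VGrading.IsSupported.of_mul_proj (fun j => (j.1 + 1, j.2)) hh).mono
      (by rintro i j rfl; exact ⟨rfl, le_rfl⟩)
  have hes : C.gr.IsSupported (fun i j => i.1 = j.1 ∧ i.2 ≤ j.2) e :=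
    (VGrading.IsSupported.of_mul_proj (fun j => j)
      (fun j => by rw [mul_assoc, he]; exact (sp.proj_mul_piM _ _).symm)).mono
      (by rintro i j rfl; exact ⟨rfl, le_rfl⟩)
  have hhδ : C.gr.IsSupported (fun i j => i.1 = j.1 ∧ i.2 < j.2) (h * (C.d - t)) :=
    hhs.mul hbd hδ fun i l j h₁ h₂ => ⟨by omega, h₁.2.trans_lt h₂.2⟩
  let r : ℤ × P → ℕ := fun i => (Finset.univ.filter (· < i.2)).card
  have hnil : (h * (C.d - t)) ^ (Fintype.card P + 1) = 0 := by
    refine VGrading.IsSupported.pow_eq_zero hbd r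
      (fun i => Nat.lt_succ_of_le (Finset.card_le_univ _)) (hhδ.mono fun i j hij => ?_)
    refine Finset.card_lt_card (Finset.ssubset_iff_of_subset ?_ |>.2 ⟨i.2, ?_, ?_⟩)
    · exact fun x hx => by simpa using (show x < i.2 by simpa using hx).trans hij.2
    · simpa using hij.2
    · simp
  obtain ⟨U, hU, hU', hUs⟩ : ∃ U : Module.End k V,
      U * (1 - h * (C.d - t)) = 1 ∧ (1 - h * (C.d - t)) * U = 1 ∧
        C.gr.IsSupported (fun i j => i.1 = j.1 ∧ i.2 ≤ j.2) U :=
    ⟨_, by rw [geom_sum_mul_neg, hnil, sub_zero], by rw [mul_neg_geom_sum, hnil, sub_zero],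
      hhδ.geom_sum hbd (fun i => ⟨rfl, le_rfl⟩)
        (fun i l j h₁ h₂ => ⟨by omega, h₁.2.le.trans h₂.2⟩) _⟩
  have hU₁ : C.gr.IsSupported (fun i j => i.1 = j.1 ∧ i.2 < j.2) (h * (C.d - t) * U) :=
    hhδ.mul hbd hUs fun i l j h₁ h₂ => ⟨by omega, h₁.2.trans_le h₂.2⟩
  have hUh : C.gr.IsSupported (fun i j => i.1 = j.1 + 1 ∧ i.2 ≤ j.2) (U * h) :=
    hUs.mul hbd hhs fun i l j h₁ h₂ => ⟨by omega, h₁.2.trans h₂.2⟩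
  have hW₁ : C.gr.IsSupported (fun i j => i.1 = j.1 ∧ i.2 < j.2) ((C.d - t) * (U * h)) :=
    hδ.mul hbd hUh fun i l j h₁ h₂ => ⟨by omega, h₁.2.trans_le h₂.2⟩
  have hWs : C.gr.IsSupported (fun i j => i.1 = j.1 ∧ i.2 ≤ j.2) (1 + (C.d - t) * (U * h)) :=
    (VGrading.IsSupported.one fun i => ⟨rfl, le_rfl⟩).add (hW₁.mono fun i j h => ⟨h.1, h.2.le⟩)
  have hGs : C.gr.IsSupported (fun i j => i.1 = j.1 ∧ i.2 ≤ j.2) (U * e) :=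
    hUs.mul hbd hes fun i l j h₁ h₂ => ⟨by omega, h₁.2.trans h₂.2⟩
  obtain ⟨h₁, h₂, h₃, h₄, h₅⟩ := ring_perturb hdd htt hhh heh hhe hee heq hU hU'
    (W := 1 + (C.d - t) * (U * h)) (by noncomm_ring)
  refine ⟨e, e * (1 + (C.d - t) * (U * h)), U * e, U * h, fun v => sp.mem_Msub_iff he hee,
    by rw [← mul_assoc, hee], by rw [mul_assoc, hee], h₁, h₂, h₃, h₄, h₅,
    hes.mul hbd hWs fun i l j h₁ h₂ => ⟨by omega, h₁.2.trans h₂.2⟩, hGs, hUh, ?_⟩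
  have hUeq : U = 1 + h * (C.d - t) * U := by
    linear_combination (norm := noncomm_ring) hU'
  have hsplit : e * (1 + (C.d - t) * (U * h)) * C.d * (U * e) =
      e * ((C.d - t) * e + (C.d * ((h * (C.d - t) * U) * e) +
        (C.d - t) * (U * h) * (C.d * (U * e)))) := by
    have hUe : U * e = e + h * (C.d - t) * U * e := by
      linear_combination (norm := noncomm_ring) hUeq * e
    linear_combination (norm := noncomm_ring) e * C.d * hUe + e * hte
  rw [hsplit]
  refine hes.mul hbd (S := fun i j => i.1 = j.1 - 1 ∧ i.2 < j.2) (.add ?_ (.add ?_ ?_))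
    fun i l j h₁ h₂ => ⟨by omega, h₁.2.trans_lt h₂.2⟩
  · exact hδ.mul hbd hes fun i l j h₁ h₂ => ⟨by omega, h₁.2.trans_le h₂.2⟩
  · refine hd.mul hbd (S := fun i j => i.1 = j.1 ∧ i.2 < j.2) ?_
      fun i l j h₁ h₂ => ⟨by omega, h₁.2.trans_lt h₂.2⟩
    exact hU₁.mul hbd hes fun i l j h₁ h₂ => ⟨by omega, h₁.2.trans_le h₂.2⟩
  · refine hW₁.mul hbd (S := fun i j => i.1 = j.1 - 1 ∧ i.2 ≤ j.2) ?_
      fun i l j h₁ h₂ => ⟨by omega, h₁.2.trans_le h₂.2⟩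
    exact hd.mul hbd hGs fun i l j h₁ h₂ => ⟨by omega, h₁.2.trans h₂.2⟩

lemma proj_apply_of_mem_range_piM {n : ℤ} {p : P} {v : V}
    (hv : v ∈ LinearMap.range (sp.piM n p)) : C.gr.proj (n, p) v = v := by
  obtain ⟨w, rfl⟩ := hv
  exact LinearMap.congr_fun (sp.proj_mul_piM n p) w

end ConsSplit

/-- Given a bounded `P`-graded chain complex of
finite-dimensional vector spaces and a consistent splitting
`C^p_n ≅ M^p_n ⊕ B^p_n ⊕ K^p_n`, there exist a `P`-graded chain complex
`(M, dM)` with chain groups `M_n = ⊕_p M^p_n` (realised on the total Morse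
summand), whose differential is `P`-filtered of degree `-1` and strict, and a
`P`-filtered contraction `(f, g, h)` from `(C, d)` onto `(M, dM)`; in
particular `(M, dM)` is a Conley complex of `(C, d)`. -/
theorem stmt0 {k V P : Type*} [Field k] [AddCommGroup V] [Module k V]
    [PartialOrder P] [Fintype P]
    (C : PCC k V P) (hbd : C.Bounded) [FiniteDimensional k V]
    (sp : ConsSplit C) :
    ∃ (dM : ↥sp.Msub →ₗ[k] ↥sp.Msub) (f : V →ₗ[k] ↥sp.Msub)
      (g : ↥sp.Msub →ₗ[k] V) (h : V →ₗ[k] V),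
      -- `(M, dM)` is a chain complex:
      dM ∘ₗ dM = 0 ∧
      -- `dM` is `P`-filtered of degree `-1`:
      (∀ (n : ℤ) (q : P) (v : ↥sp.Msub), (v : V) ∈ LinearMap.range (sp.piM n q) →
        ∀ (m : ℤ) (p : P), ¬ (m = n - 1 ∧ p ≤ q) →
          C.gr.proj (m, p) ((dM v : V)) = 0) ∧
      -- `dM` is strict:
      (∀ (n : ℤ) (p : P) (v : ↥sp.Msub), (v : V) ∈ LinearMap.range (sp.piM n p) →
        C.gr.proj (n - 1, p) ((dM v : V)) = 0) ∧
      -- `(f, g, h)` is a contraction from `(C, d)` onto `(M, dM)`: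
      IsContraction C.d dM f g h ∧
      -- `f`, `g` and `h` are `P`-filtered:
      PFilt C.gr C.gr (sp.Msub.subtype ∘ₗ f) ∧
      (∀ (n : ℤ) (q : P) (v : ↥sp.Msub), (v : V) ∈ LinearMap.range (sp.piM n q) →
        ∀ (m : ℤ) (p : P), ¬ p ≤ q → C.gr.proj (m, p) (g v) = 0) ∧
      PFilt C.gr C.gr h := by
  obtain ⟨e, F, G, H, hM, heF, hGe, hFG, hGF, hFH, hHG, hHH, hFs, hGs, hHs, hDs⟩ :=
    sp.exists_perturbed_contraction hbd
  have hdd : (C.d * C.d : Module.End k V) = 0 := C.d_sq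
  have hFdH : F * C.d * H = 0 := by
    linear_combination (norm := noncomm_ring) -(F * hGF) + hFG * F + heF - hFH * C.d
  have hHdG : H * C.d * G = 0 := by
    linear_combination (norm := noncomm_ring) -(hGF * G) + G * hFG + hGe - C.d * hHG
  have hFd : F * C.d = F * C.d * G * F := by
    linear_combination (norm := noncomm_ring) -(F * C.d * hGF) - F * hdd * H - hFdH * C.d
  have hdG : G * (F * C.d * G) = C.d * G := by
    linear_combination (norm := noncomm_ring) hGF * C.d * G + C.d * hHdG + H * hdd * G
  have hDD : F * C.d * G * (F * C.d * G) = 0 := by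
    linear_combination (norm := noncomm_ring) F * C.d * hdG + F * hdd * G
  have happ {f g : Module.End k V} (hfg : f = g) (v : V) : f v = g v := LinearMap.congr_fun hfg v
  let f : V →ₗ[k] sp.Msub := F.codRestrict sp.Msub fun v => (hM _).2 (happ heF v)
  let g : sp.Msub →ₗ[k] V := G ∘ₗ sp.Msub.subtype
  have hcomp {R : ℤ × P → ℤ × P → Prop} {T : Module.End k V} (hT : C.gr.IsSupported R T)
      {n : ℤ} {q : P} {v : V} (hv : v ∈ LinearMap.range (sp.piM n q)) {i : ℤ × P}
      (hi : ¬ R i (n, q)) : C.gr.proj i (T v) = 0 := by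
    rw [← sp.proj_apply_of_mem_range_piM hv]
    exact happ (hT i (n, q) hi) v
  refine ⟨f ∘ₗ C.d ∘ₗ g, f, g, H, ?_, ?_, ?_, ⟨?_, ?_, ?_, ?_, ?_, ?_, ?_⟩, ?_, ?_, ?_⟩
  · ext v
    exact happ hDD v
  · exact fun n q v hv m p hmp => hcomp hDs hv fun h => hmp ⟨h.1, h.2.le⟩
  · exact fun n p v hv => hcomp hDs hv fun h => lt_irrefl _ h.2
  · ext v
    exact happ hFd v
  · ext v
    exact happ hdG v
  · ext v
    exact (happ hFG v).trans ((hM v).1 v.2)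
  · exact hGF
  · ext v
    exact happ hFH v
  · ext v
    exact happ hHG v
  · exact hHH
  · exact fun n m p q hpq => hFs _ _ fun h => hpq h.2
  · exact fun n q v hv m p hpq => hcomp hGs hv fun h => hpq h.2
  · exact fun n m p q hpq => hHs _ _ fun h => hpq h.2
end

section
/- Let (K,d) be a based complex over a field whose digraph G_K is finite, and let μ be a partial matching on G_K such that the component d^{βα} is an isomorphism for every edge (α → β) ∈ μ. Then μ is a Morse matching if and only if the digraph G^μ_K has no directed cycles. -/
open LinearMap Submodule

/-- Every vertex on a cycle has a successor on a cycle. -/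
theorem Relation.TransGen.exists_next {α : Type*} {r : α → α → Prop} {a : α}
    (h : Relation.TransGen r a a) : ∃ b, r a b ∧ Relation.TransGen r b b := by
  obtain ⟨b, hab, hba⟩ := Relation.TransGen.head'_iff.mp h
  exact ⟨b, hab, Relation.TransGen.tail' hba hab⟩

namespace BasedComplex

variable {k V ι : Type*} [Field k] [AddCommGroup V] [Module k V]
  {K : BasedComplex k V ι} {μ : Set (ι × ι)}

theorem Edge.deg_eq {α β : ι} (h : K.Edge α β) : K.deg β = K.deg α - 1 := by
  by_contra hne
  exact h (K.d_comp_deg α β hne)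

theorem IsPartialMatching.deg_eq (hpm : K.IsPartialMatching μ) {α β : ι}
    (h : (α, β) ∈ μ) : K.deg β = K.deg α - 1 :=
  Edge.deg_eq (hpm.1 _ h)

/-- A target of a matched edge is not the source of a matched edge. -/
theorem IsPartialMatching.notMem_of_mem (hpm : K.IsPartialMatching μ) {α β γ : ι}
    (h : (α, β) ∈ μ) : (β, γ) ∉ μ := by
  intro h'
  have hne : (α, β) ≠ (β, γ) := by
    intro he
    have h_eq : α = β := congrArg Prod.fst he
    have hdeg := hpm.deg_eq h
    rw [h_eq] at hdeg
    omega
  exact (hpm.2 _ h _ h' hne).2.2.1 rfl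

/-- `G^μ_K` has no directed cycles: among the vertices of least degree lying on cycles, a minimal
one for the order would be followed, two steps later, by a smaller one. -/
theorem IsMorseMatching.acyclic [Finite ι] (h : K.IsMorseMatching μ) (α : ι) :
    ¬ Relation.TransGen (K.MuEdge μ) α α := by
  intro hα
  obtain ⟨hpm, -, r, -, -, hwf, hr⟩ := h
  obtain ⟨m, hm, hmin⟩ := Set.exists_min_image
    {a | Relation.TransGen (K.MuEdge μ) a a} K.deg (Set.toFinite _) ⟨α, hα⟩
  obtain ⟨a, ⟨ha, ham⟩, hamin⟩ := hwf.has_min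
    {a | Relation.TransGen (K.MuEdge μ) a a ∧ K.deg a = K.deg m} ⟨m, hm, rfl⟩
  obtain ⟨b, hab, hb⟩ := ha.exists_next
  obtain ⟨c, hbc, hc⟩ := hb.exists_next
  have hba : (b, a) ∈ μ := by
    refine hab.resolve_left fun hdown => ?_
    have := hdown.1.deg_eq
    have := hmin b hb
    omega
  have hdown : K.Edge b c := (hbc.resolve_right fun hup => hpm.notMem_of_mem hup hba).1
  have hca : K.deg c = K.deg a := by
    rw [hdown.deg_eq, hpm.deg_eq hba]
  exact hamin c ⟨hc, hca.trans ham⟩ (hr a b c hca hab hbc)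

theorem isMorseMatching_of_acyclic [Finite ι] (hpm : K.IsPartialMatching μ)
    (hiso : ∀ e ∈ μ, K.CompIso e.1 e.2)
    (hac : ∀ α : ι, ¬ Relation.TransGen (K.MuEdge μ) α α) : K.IsMorseMatching μ := by
  let r : ι → ι → Prop := fun a b => K.deg a = K.deg b ∧ Relation.TransGen (K.MuEdge μ) b a
  have htrans : ∀ a b c, r a b → r b c → r a c := fun _ _ _ hab hbc =>
    ⟨hab.1.trans hbc.1, hbc.2.trans hab.2⟩
  have : IsTrans ι r := ⟨htrans⟩
  have : Std.Irrefl r := ⟨fun a h => hac a h.2⟩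
  exact ⟨hpm, hiso, r, fun _ _ h => h.1, fun a b c => htrans a b c,
    Finite.wellFounded_of_trans_of_irrefl r,
    fun _ _ _ hdeg h₁ h₂ => ⟨hdeg, (Relation.TransGen.single h₁).tail h₂⟩⟩

end BasedComplex

/-- Let `(K, d)` be a based complex whose digraph `G_K` is
finite, and let `μ` be a partial matching on `G_K` such that `d^{βα}` is an
isomorphism for every edge `(α → β) ∈ μ`.  Then `μ` is a Morse matching if
and only if the digraph `G^μ_K` has no directed cycles. -/
theorem stmt1 {k V ι : Type*} [Field k] [AddCommGroup V] [Module k V] [Finite ι]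
    (K : BasedComplex k V ι) (μ : Set (ι × ι))
    (hpm : K.IsPartialMatching μ)
    (hiso : ∀ e ∈ μ, K.CompIso e.1 e.2) :
    K.IsMorseMatching μ ↔ ∀ α : ι, ¬ Relation.TransGen (K.MuEdge μ) α α := by
  exact ⟨fun h => h.acyclic, BasedComplex.isMorseMatching_of_acyclic hpm hiso⟩
end

section
/- (Brown–Gugenheim perturbation lemma.) Let (f,g,h) be a contraction from a chain complex (C,d^C) over a field onto a chain complex (D,d^D), and let δ be a perturbation of C such that hδ is locally nilpotent. Set S = Σ_{n≥0} δ(hδ)^n (well-defined by local nilpotency), f' = f + fSh, g' = g + hSg, h' = h + hSh, and δ' = fSg. Then δ' is a perturbation of D (i.e., (d^D + δ')² = 0) and (f', g', h') is a contraction from the perturbed complex (C, d^C + δ) onto the perturbed complex (D, d^D + δ'). -/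
open LinearMap Submodule

section PerturbSum

variable {k V : Type*} [Field k] [AddCommGroup V] [Module k V]

theorem endPow_succ_apply (a : V →ₗ[k] V) (n : ℕ) (v : V) :
    endPow a (n + 1) v = endPow a n (a v) := by
  induction n with
  | zero => rfl
  | succ n ih => exact congrArg a ih

namespace IsPerturbSum

variable {δ h S : V →ₗ[k] V}

/-- The defining series may be truncated at any sufficiently large index. -/
theorem exists_forall_eq_sum (hS : IsPerturbSum δ h S) (v : V) :
    ∃ N : ℕ, ∀ M : ℕ, N ≤ M →
      S v = ∑ i ∈ Finset.range M, δ (endPow (h ∘ₗ δ) i v) := by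
  obtain ⟨N, hN, hSv⟩ := hS v
  refine ⟨N, fun M hM => ?_⟩
  rw [hSv]
  refine Finset.sum_subset (Finset.range_mono hM) fun i _ hi => ?_
  rw [LinearMap.comp_apply, hN i (by simpa using hi), map_zero]

theorem eq_add_left (hS : IsPerturbSum δ h S) (v : V) : S v = δ v + δ (h (S v)) := by
  obtain ⟨N, hN⟩ := hS.exists_forall_eq_sum v
  have hS' : δ (h (S v)) = ∑ i ∈ Finset.range N, δ (endPow (h ∘ₗ δ) (i + 1) v) := by
    rw [hN N le_rfl, map_sum, map_sum]
    rfl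
  rw [hS', hN (N + 1) N.le_succ, Finset.sum_range_succ', add_comm]
  rfl

theorem eq_add_right (hS : IsPerturbSum δ h S) (v : V) : S v = δ v + S (h (δ v)) := by
  obtain ⟨N, hN⟩ := hS.exists_forall_eq_sum v
  obtain ⟨N', hN'⟩ := hS.exists_forall_eq_sum (h (δ v))
  rw [hN (max N N' + 1) (by omega), hN' (max N N') (by omega), Finset.sum_range_succ', add_comm]
  congr 1
  refine Finset.sum_congr rfl fun i _ => ?_
  rw [endPow_succ_apply]
  rfl

/-- The identity `S (1 + d h + h d) S + S d + d S = 0`, which says that the transferred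
perturbation squares to zero with the differential. -/
theorem sandwich_add_comm_eq_zero (hS : IsPerturbSum δ h S) {d : V →ₗ[k] V}
    (hd : d ∘ₗ d = 0) (hpert : (d + δ) ∘ₗ (d + δ) = 0) (v : V) :
    S (S v + d (h (S v)) + h (d (S v))) + S (d v) + d (S v) = 0 := by
  have key : d * δ + δ * d + δ * δ = 0 := by
    have hd' : d * d = 0 := hd
    have hp : (d + δ) * (d + δ) = 0 := hpert
    rw [← hp, add_mul, mul_add, mul_add, hd']
    abel
  have hl : S = δ + δ * h * S := LinearMap.ext hS.eq_add_left
  have hr : S = δ + S * h * δ := LinearMap.ext hS.eq_add_right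
  have hl' : S - δ * h * S = δ := sub_eq_of_eq_add hl
  have hr' : S - S * h * δ = δ := sub_eq_of_eq_add hr
  have inv_l : (1 + S * h) * (1 - δ * h) = 1 := by
    calc _ = 1 + ((S - S * h * δ) - δ) * h := by noncomm_ring
      _ = 1 := by rw [hr', sub_self, zero_mul, add_zero]
  have inv_r : (1 - h * δ) * (1 + h * S) = 1 := by
    calc _ = 1 + h * ((S - δ * h * S) - δ) := by noncomm_ring
      _ = 1 := by rw [hl', sub_self, mul_zero, add_zero]
  set X := S * (1 + d * h + h * d) * S + S * d + d * S with hX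
  have conj : (1 - δ * h) * X * (1 - h * δ) = 0 := by
    calc _ = (S - δ * h * S) * (1 + d * h + h * d) * (S - S * h * δ)
          + (S - δ * h * S) * d * (1 - h * δ) + (1 - δ * h) * d * (S - S * h * δ) := by
            rw [hX]; noncomm_ring
      _ = d * δ + δ * d + δ * δ := by rw [hl', hr']; noncomm_ring
      _ = 0 := key
  have hX0 : X = 0 := by
    calc X = ((1 + S * h) * (1 - δ * h)) * X * ((1 - h * δ) * (1 + h * S)) := by
            rw [inv_l, inv_r, one_mul, mul_one]
      _ = (1 + S * h) * ((1 - δ * h) * X * (1 - h * δ)) * (1 + h * S) := by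
            simp only [mul_assoc]
      _ = 0 := by rw [conj, mul_zero, zero_mul]
  exact LinearMap.congr_fun hX0 v

end IsPerturbSum

end PerturbSum

/-- **Brown–Gugenheim perturbation lemma.** Let `(f, g, h)` be a
contraction from `(C, dC)` onto `(D, dD)` and let `δ` be a perturbation of `C`
such that `hδ` is locally nilpotent.  With `S = Σ_{n ≥ 0} δ (hδ)^n`,
`f' = f + fSh`, `g' = g + hSg`, `h' = h + hSh` and `δ' = fSg`, the map `δ'`
is a perturbation of `D` and `(f', g', h')` is a contraction from
`(C, dC + δ)` onto `(D, dD + δ')`. -/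
theorem stmt2 {k V W : Type*} [Field k] [AddCommGroup V] [Module k V]
    [AddCommGroup W] [Module k W]
    (C : ZCC k V) (D : ZCC k W)
    (f : V →ₗ[k] W) (g : W →ₗ[k] V) (h : V →ₗ[k] V)
    (hfdeg : HasDeg C.gr D.gr f 0) (hgdeg : HasDeg D.gr C.gr g 0)
    (hhdeg : HasDeg C.gr C.gr h 1)
    (hc : IsContraction C.d D.d f g h)
    (δ : V →ₗ[k] V) (hδdeg : HasDeg C.gr C.gr δ (-1))
    (hpert : (C.d + δ) ∘ₗ (C.d + δ) = 0)
    (hnil : ∀ v : V, ∃ m : ℕ, endPow (h ∘ₗ δ) m v = 0)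
    (S : V →ₗ[k] V) (hS : IsPerturbSum δ h S) :
    ((D.d + f ∘ₗ (S ∘ₗ g)) ∘ₗ (D.d + f ∘ₗ (S ∘ₗ g)) = 0) ∧
    IsContraction (C.d + δ) (D.d + f ∘ₗ (S ∘ₗ g))
      (f + f ∘ₗ (S ∘ₗ h)) (g + h ∘ₗ (S ∘ₗ g)) (h + h ∘ₗ (S ∘ₗ h)) := by
  have f_chain : ∀ v, D.d (f v) = f (C.d v) := fun v => (LinearMap.congr_fun hc.f_chain v).symm
  have g_chain : ∀ w, g (D.d w) = C.d (g w) := LinearMap.congr_fun hc.g_chain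
  have fg : ∀ w, f (g w) = w := LinearMap.congr_fun hc.fg
  have gf : ∀ v, g (f v) = v + C.d (h v) + h (C.d v) := LinearMap.congr_fun hc.gf
  have fh : ∀ v, f (h v) = 0 := LinearMap.congr_fun hc.fh
  have hg : ∀ w, h (g w) = 0 := LinearMap.congr_fun hc.hg
  have hh : ∀ v, h (h v) = 0 := LinearMap.congr_fun hc.hh
  have d_sq : ∀ w, D.d (D.d w) = 0 := LinearMap.congr_fun D.d_sq
  have hl : ∀ v, δ (h (S v)) = S v - δ v := fun v => eq_sub_of_add_eq' (hS.eq_add_left v).symm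
  have hr : ∀ v, S (h (δ v)) = S v - δ v := fun v => eq_sub_of_add_eq' (hS.eq_add_right v).symm
  have hX : ∀ v, S (S v) =
      -(S (C.d (h (S v))) + S (h (C.d (S v))) + S (C.d v) + C.d (S v)) := fun v => by
    have := hS.sandwich_add_comm_eq_zero C.d_sq hpert v
    simp only [map_add] at this
    rw [eq_neg_iff_add_eq_zero, ← this]
    abel
  refine ⟨?_, ?_, ?_, ?_, ?_, ?_, ?_, ?_⟩ <;> ext v <;>
    simp only [LinearMap.comp_apply, LinearMap.add_apply, LinearMap.id_apply,
      LinearMap.zero_apply, map_add, map_neg, map_sub, map_zero, f_chain, g_chain, fg, gf, fh, hg,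
      hh, d_sq, hl, hr, hX, add_zero, zero_add] <;>
    abel
end

section
/- Let k be a field, P a finite poset, and (C,d) a bounded P-graded chain complex of finite-dimensional k-vector spaces with a consistent splitting C^p_n ≅ M^p_n ⊕ B^p_n ⊕ K^p_n. Let f̃ = j_M (projection onto the total summand M = ⊕_p M^p), g̃ = i_M (inclusion of M), h̃ = −i_K ∘ (⊕_p (t^p|_{K^p})^{-1}) ∘ j_B (minus the inverses of the isomorphisms t^p : K^p_n → B^p_{n-1}), δ = Σ_{p<q} t^{pq} (the sum of all components of d between distinct grades), and S = Σ_{n≥0} δ(h̃δ)^n. Then, with d^M = f̃ S g̃, the triple (f, g, h) given by f = f̃ + f̃Sh̃, g = g̃ + h̃Sg̃, h = h̃ + h̃Sh̃ is a P-filtered contraction from (C,d) onto (M, d^M). -/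
open LinearMap Submodule

/-! ## Perturbation series -/

section Perturbation

variable {k V W : Type*} [Field k] [AddCommGroup V] [Module k V]
  [AddCommGroup W] [Module k W]

theorem endPow_eq_pow (f : Module.End k V) (n : ℕ) : endPow f n = f ^ n := by
  induction n with
  | zero => rfl
  | succ n ih => rw [endPow, ih, pow_succ']; rfl

theorem IsPerturbSum.exists_sum_range {δ h S : Module.End k V} (hS : IsPerturbSum δ h S) (v : V) :
    ∃ N : ℕ, ∀ m, N ≤ m → S v = ∑ i ∈ Finset.range m, (δ * (h * δ) ^ i) v := by
  obtain ⟨N, hN, hv⟩ := hS v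
  refine ⟨N, fun m hm => ?_⟩
  simp only [endPow_eq_pow] at hN hv
  rw [hv]
  refine Finset.sum_subset (by simpa using hm) fun i _ hi => ?_
  have := hN i (by simpa using hi)
  rw [comp_apply, this, map_zero]

theorem IsPerturbSum.eq_add_left_s4 {δ h S : Module.End k V} (hS : IsPerturbSum δ h S) :
    S = δ + δ * h * S := by
  ext v
  obtain ⟨N, hN⟩ := hS.exists_sum_range v
  rw [hN (N + 1) N.le_succ, Finset.sum_range_succ']
  simp only [LinearMap.add_apply, Module.End.mul_apply, hN N le_rfl, map_sum, pow_succ',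
    pow_zero, Module.End.one_apply]
  rw [add_comm]

theorem IsPerturbSum.eq_add_right_s4 {δ h S : Module.End k V} (hS : IsPerturbSum δ h S) :
    S = δ + S * h * δ := by
  ext v
  obtain ⟨N, hN⟩ := hS.exists_sum_range v
  obtain ⟨N', hN'⟩ := hS.exists_sum_range (h (δ v))
  rw [hN (max N N' + 1) (by omega), Finset.sum_range_succ']
  simp only [LinearMap.add_apply, Module.End.mul_apply, hN' (max N N') (by omega), pow_succ,
    pow_zero, Module.End.one_apply]
  rw [add_comm]

theorem IsPerturbSum.mem_of_mem {δ h S : Module.End k V} (hS : IsPerturbSum δ h S)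
    {F : Submodule k V} (hδ : ∀ v ∈ F, δ v ∈ F) (hh : ∀ v ∈ F, h v ∈ F) :
    ∀ v ∈ F, S v ∈ F := by
  intro v hv
  obtain ⟨N, hN⟩ := hS.exists_sum_range v
  rw [hN N le_rfl]
  refine Submodule.sum_mem _ fun i _ => hδ _ ?_
  clear * - hδ hh hv
  induction i with
  | zero => exact hv
  | succ i ih => rw [pow_succ']; exact hh _ (hδ _ ih)

/-- The key identity of the basic perturbation lemma. -/
theorem perturb_mul_mul_add {R : Type*} [Ring R] {t δ h A : R} (ht : t * t = 0)
    (hd : (t + δ) * (t + δ) = 0) (hl : A = δ + δ * h * A) (hr : A = δ + A * h * δ) :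
    A * (1 + t * h + h * t) * A + A * t + t * A = 0 := by
  set X := A * (1 + t * h + h * t) * A + A * t + t * A with hX
  have h1 : (1 - δ * h) * A = δ := by rw [sub_mul, one_mul, sub_eq_iff_eq_add]; exact hl
  have h2 : A * (1 - h * δ) = δ := by
    rw [mul_sub, mul_one, sub_eq_iff_eq_add, ← mul_assoc]; exact hr
  have h3 : (1 + A * h) * (1 - δ * h) = 1 := by
    calc _ = 1 + (A - (δ + A * h * δ)) * h := by noncomm_ring
      _ = 1 := by rw [← hr, sub_self, zero_mul, add_zero]
  have h4 : (1 - h * δ) * (1 + h * A) = 1 := by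
    calc _ = 1 + h * (A - (δ + δ * h * A)) := by noncomm_ring
      _ = 1 := by rw [← hl, sub_self, mul_zero, add_zero]
  have h5 : (1 - δ * h) * X * (1 - h * δ) = 0 := by
    calc _ = ((1 - δ * h) * A) * (1 + t * h + h * t) * (A * (1 - h * δ))
          + ((1 - δ * h) * A) * t * (1 - h * δ) + (1 - δ * h) * t * (A * (1 - h * δ)) := by
            rw [hX]; noncomm_ring
      _ = (t + δ) * (t + δ) - t * t := by rw [h1, h2]; noncomm_ring
      _ = 0 := by rw [hd, ht, sub_zero]
  calc X = ((1 + A * h) * (1 - δ * h)) * X * ((1 - h * δ) * (1 + h * A)) := by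
        rw [h3, h4, one_mul, mul_one]
    _ = (1 + A * h) * ((1 - δ * h) * X * (1 - h * δ)) * (1 + h * A) := by noncomm_ring
    _ = 0 := by rw [h5, mul_zero, zero_mul]

/-- The **basic perturbation lemma** for a contraction onto a complex with zero differential. -/
theorem IsContraction.perturb {t δ h S : Module.End k V} {f : V →ₗ[k] W} {g : W →ₗ[k] V}
    (H : IsContraction t 0 f g h) (ht : t * t = 0) (hd : (t + δ) * (t + δ) = 0)
    (hS : IsPerturbSum δ h S) :
    IsContraction (t + δ) (f ∘ₗ S ∘ₗ g) (f + f ∘ₗ S ∘ₗ h) (g + h ∘ₗ S ∘ₗ g)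
      (h + h ∘ₗ S ∘ₗ h) := by
  have hl := hS.eq_add_left_s4
  have hr := hS.eq_add_right_s4
  have key := perturb_mul_mul_add ht hd hl hr
  have hπ : 1 + t * h + h * t = g ∘ₗ f := H.gf.symm
  rw [hπ] at key
  have ft : ∀ v, f (t v) = 0 := fun v => by simpa using LinearMap.congr_fun H.f_chain v
  have tg : ∀ w, t (g w) = 0 := fun w => by simpa using (LinearMap.congr_fun H.g_chain w).symm
  have fg : ∀ w, f (g w) = w := fun w => LinearMap.congr_fun H.fg w
  have fh : ∀ v, f (h v) = 0 := fun v => LinearMap.congr_fun H.fh v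
  have hg : ∀ w, h (g w) = 0 := fun w => LinearMap.congr_fun H.hg w
  have hh : ∀ v, h (h v) = 0 := fun v => LinearMap.congr_fun H.hh v
  have gf : ∀ v, g (f v) = v + t (h v) + h (t v) := fun v => LinearMap.congr_fun H.gf v
  have key' : ∀ v, S (g (f (S v))) = - S (t v) - t (S v) := fun v => by
    have := LinearMap.congr_fun key v
    simp only [LinearMap.add_apply, Module.End.mul_apply, comp_apply, LinearMap.zero_apply] at this
    rw [← sub_eq_zero, ← this]; abel
  have hl' : ∀ v, δ (h (S v)) = S v - δ v := fun v => by
    have := LinearMap.congr_fun hl v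
    simp only [LinearMap.add_apply, Module.End.mul_apply] at this
    rw [eq_sub_iff_add_eq', ← this]
  have hr' : ∀ v, S (h (δ v)) = S v - δ v := fun v => by
    have := LinearMap.congr_fun hr v
    simp only [LinearMap.add_apply, Module.End.mul_apply] at this
    rw [eq_sub_iff_add_eq', ← this]
  constructor
  · ext v
    simp only [LinearMap.add_apply, comp_apply, map_add, ft, hr', map_sub, key', map_neg]
    simp only [gf, map_add]
    abel
  · ext w
    simp only [LinearMap.add_apply, comp_apply, map_add, tg, hl', key', map_sub, map_neg, map_zero]
    simp only [gf]
    abel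
  · ext w
    simp [fg, fh, hg, hh]
  · ext v
    simp only [LinearMap.add_apply, comp_apply, map_add, hl', hr', map_sub, key', map_neg,
      id_apply]
    simp only [gf, map_add]
    abel
  · ext v
    simp [fh, hh]
  · ext w
    simp [hg, hh]
  · ext v
    simp [hh]

end Perturbation

/-! ## Maps between graded spaces -/

namespace VGrading

variable {k V W ι : Type*} [Field k] [AddCommGroup V] [Module k V] [AddCommGroup W] [Module k W]

theorem hom_ext (G : VGrading k V ι) {f g : V →ₗ[k] W}
    (h : ∀ i, f ∘ₗ G.proj i = g ∘ₗ G.proj i) : f = g := by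
  ext v
  rw [← G.proj_total v, map_finsum f (G.proj_finite v), map_finsum g (G.proj_finite v)]
  exact finsum_congr fun i => LinearMap.congr_fun (h i) v

theorem finsum_comp_proj (G : VGrading k V ι) (hfin : {i | G.proj i ≠ 0}.Finite)
    {F : ι → V →ₗ[k] W} (hF : ∀ i, F i ∘ₗ G.proj i = F i) (j : ι) :
    (∑ᶠ i, F i) ∘ₗ G.proj j = F j := by
  have hsupp : Function.support F ⊆ {i | G.proj i ≠ 0} := fun i hi h0 => hi <| by
    rw [← hF i, h0, comp_zero]
  change LinearMap.lcomp k W (G.proj j) (∑ᶠ i, F i) = F j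
  rw [map_finsum _ (hfin.subset hsupp), finsum_eq_single _ j]
  · exact hF j
  · intro i hi
    change F i ∘ₗ G.proj j = 0
    rw [← hF i, comp_assoc, G.proj_orth i j hi, comp_zero]

variable {P : Type*} [PartialOrder P]

/-- The vectors whose components vanish at all grades not below `q`. -/
def below (G : VGrading k V (ℤ × P)) (q : P) : Submodule k V :=
  ⨅ (i : ℤ × P) (_ : ¬ i.2 ≤ q), LinearMap.ker (G.proj i)

theorem mem_below {G : VGrading k V (ℤ × P)} {q : P} {v : V} :
    v ∈ G.below q ↔ ∀ i : ℤ × P, ¬ i.2 ≤ q → G.proj i v = 0 := by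
  simp [below]

theorem proj_mem_below (G : VGrading k V (ℤ × P)) (n : ℤ) (q : P) (v : V) :
    G.proj (n, q) v ∈ G.below q := by
  rw [mem_below]
  intro i hi
  exact LinearMap.congr_fun (G.proj_orth i (n, q) fun h => hi (by rw [h])) v

end VGrading

theorem pFilt_iff_below {k V P : Type*} [Field k] [AddCommGroup V] [Module k V] [PartialOrder P]
    {G : VGrading k V (ℤ × P)} {f : V →ₗ[k] V} :
    PFilt G G f ↔ ∀ q, ∀ v ∈ G.below q, f v ∈ G.below q := by
  constructor
  · intro hf q v hv
    rw [VGrading.mem_below] at hv ⊢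
    intro i hi
    rw [← G.proj_total v, map_finsum f (G.proj_finite v),
      map_finsum (G.proj i) ((G.proj_finite v).subset fun j hj h0 => hj (by simp [h0]))]
    refine finsum_eq_zero_of_forall_eq_zero fun j => ?_
    by_cases hj : j.2 ≤ q
    · exact LinearMap.congr_fun (hf j.1 i.1 i.2 j.2 fun h => hi (h.trans hj)) v
    · rw [hv j hj, map_zero, map_zero]
  · intro hf n m p q hpq
    ext v
    exact VGrading.mem_below.1 (hf q _ (G.proj_mem_below n q v)) (m, p) hpq

/-! ## The contraction of the diagonal part -/

namespace ConsSplit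

variable {k V P : Type*} [Field k] [AddCommGroup V] [Module k V] [PartialOrder P]
  {C : PCC k V P} (sp : ConsSplit C)

theorem piM_comp_proj (n : ℤ) (p : P) : sp.piM n p ∘ₗ C.gr.proj (n, p) = sp.piM n p := by
  rw [← sp.sum_eq, comp_add, comp_add, sp.idem_M, sp.orth_MB, sp.orth_MK, add_zero, add_zero]

theorem proj_comp_piM (n : ℤ) (p : P) : C.gr.proj (n, p) ∘ₗ sp.piM n p = sp.piM n p := by
  rw [← sp.sum_eq, add_comp, add_comp, sp.idem_M, sp.orth_BM, sp.orth_KM, add_zero, add_zero]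

theorem proj_comp_piB (n : ℤ) (p : P) : C.gr.proj (n, p) ∘ₗ sp.piB n p = sp.piB n p := by
  rw [← sp.sum_eq, add_comp, add_comp, sp.idem_B, sp.orth_MB, sp.orth_KB, zero_add, add_zero]

theorem proj_comp_piK (n : ℤ) (p : P) : C.gr.proj (n, p) ∘ₗ sp.piK n p = sp.piK n p := by
  rw [← sp.sum_eq, add_comp, add_comp, sp.idem_K, sp.orth_MK, sp.orth_BK, zero_add, zero_add]

include sp in
theorem hom_ext {W : Type*} [AddCommGroup W] [Module k W] {f g : V →ₗ[k] W}
    (hM : ∀ n p v, f (sp.piM n p v) = g (sp.piM n p v))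
    (hB : ∀ n p v, f (sp.piB n p v) = g (sp.piB n p v))
    (hK : ∀ n p v, f (sp.piK n p v) = g (sp.piK n p v)) : f = g := by
  refine C.gr.hom_ext fun ⟨n, p⟩ => ?_
  ext v
  simp only [← sp.sum_eq, comp_apply, LinearMap.add_apply, map_add, hM, hB, hK]

end ConsSplit

namespace PCC

variable {k V P : Type*} [Field k] [AddCommGroup V] [Module k V] [PartialOrder P]
  {C : PCC k V P}

theorem dtilde_proj (hbd : C.Bounded) (n : ℤ) (p : P) (v : V) :
    C.dtilde (C.gr.proj (n, p) v) = C.tcomp n p p v :=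
  LinearMap.congr_fun (C.gr.finsum_comp_proj hbd
    (F := fun i => C.gr.proj (i.1 - 1, i.2) ∘ₗ (C.d ∘ₗ C.gr.proj i))
    (fun i => by simp only [comp_assoc, C.gr.proj_idem]) (n, p)) v

theorem pFilt_d : PFilt C.gr C.gr C.d := fun n m p q hpq =>
  (C.d_filt n m p q).resolve_left fun h => hpq h.2

theorem pFilt_dtilde (hbd : C.Bounded) : PFilt C.gr C.gr C.dtilde := by
  intro n m p q hpq
  ext v
  simp only [comp_apply, dtilde_proj hbd, tcomp, LinearMap.zero_apply]
  exact LinearMap.congr_fun (C.gr.proj_orth (m, p) (n - 1, q) fun h =>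
    hpq (congrArg Prod.snd h).le) _

end PCC

namespace ConsSplit

variable {k V P : Type*} [Field k] [AddCommGroup V] [Module k V] [PartialOrder P]
  {C : PCC k V P} (sp : ConsSplit C)

theorem tcomp_piM (n : ℤ) (p : P) (v : V) : C.tcomp n p p (sp.piM n p v) = 0 :=
  ((sp.ker_split n p).le (mem_sup_left (mem_range_self _ v))).2

theorem tcomp_piB (n : ℤ) (p : P) (v : V) : C.tcomp n p p (sp.piB n p v) = 0 :=
  ((sp.ker_split n p).le (mem_sup_right (mem_range_self _ v))).2

theorem tcomp_piK_mem (n : ℤ) (p : P) (v : V) :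
    C.tcomp n p p (sp.piK n p v) ∈ LinearMap.range (sp.piB (n - 1) p) :=
  (sp.K_onto n p).le (mem_map_of_mem (mem_range_self _ v))

section Bounded

variable (hbd : C.Bounded)
include hbd

theorem dtilde_piM (n : ℤ) (p : P) (v : V) : C.dtilde (sp.piM n p v) = 0 := by
  rw [← sp.proj_comp_piM, comp_apply, PCC.dtilde_proj hbd, tcomp_piM]

theorem dtilde_piB (n : ℤ) (p : P) (v : V) : C.dtilde (sp.piB n p v) = 0 := by
  rw [← sp.proj_comp_piB, comp_apply, PCC.dtilde_proj hbd, tcomp_piB]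

theorem dtilde_piK (n : ℤ) (p : P) (v : V) :
    C.dtilde (sp.piK n p v) = C.tcomp n p p (sp.piK n p v) := by
  conv_lhs => rw [← sp.proj_comp_piK, comp_apply, PCC.dtilde_proj hbd]

theorem projM_proj (n : ℤ) (p : P) (v : V) :
    sp.projM (C.gr.proj (n, p) v) = sp.piM n p v :=
  LinearMap.congr_fun (C.gr.finsum_comp_proj hbd (F := fun i => sp.piM i.1 i.2)
    (fun i => sp.piM_comp_proj i.1 i.2) (n, p)) v

theorem projM_piM (n : ℤ) (p : P) (v : V) : sp.projM (sp.piM n p v) = sp.piM n p v := by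
  conv_lhs => rw [← sp.proj_comp_piM, comp_apply, sp.projM_proj hbd]
  exact LinearMap.congr_fun (sp.idem_M n p) v

theorem projM_piB (n : ℤ) (p : P) (v : V) : sp.projM (sp.piB n p v) = 0 := by
  rw [← sp.proj_comp_piB, comp_apply, sp.projM_proj hbd]
  exact LinearMap.congr_fun (sp.orth_MB n p) v

theorem projM_piK (n : ℤ) (p : P) (v : V) : sp.projM (sp.piK n p v) = 0 := by
  rw [← sp.proj_comp_piK, comp_apply, sp.projM_proj hbd]
  exact LinearMap.congr_fun (sp.orth_MK n p) v

theorem pFilt_projM : PFilt C.gr C.gr sp.projM := by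
  intro n m p q hpq
  ext v
  simp only [comp_apply, sp.projM_proj hbd, LinearMap.zero_apply]
  rw [← sp.proj_comp_piM]
  exact LinearMap.congr_fun (C.gr.proj_orth (m, p) (n, q) fun h => hpq (congrArg Prod.snd h).le) _

theorem projM_mem (v : V) : sp.projM v ∈ sp.Msub := by
  rw [← C.gr.proj_total v, map_finsum _ (C.gr.proj_finite v)]
  refine finsum_induction (· ∈ sp.Msub) (zero_mem _) (fun _ _ => add_mem) fun i => ?_
  rw [show i = (i.1, i.2) from rfl, sp.projM_proj hbd]
  exact mem_iSup_of_mem i (mem_range_self _ v)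

theorem projM_of_mem {v : V} (hv : v ∈ sp.Msub) : sp.projM v = v := by
  have : sp.Msub ≤ LinearMap.eqLocus sp.projM LinearMap.id := by
    refine iSup_le fun i => ?_
    rintro _ ⟨w, rfl⟩
    exact sp.projM_piM hbd i.1 i.2 w
  exact this hv

theorem dtilde_of_mem {v : V} (hv : v ∈ sp.Msub) : C.dtilde v = 0 := by
  have : sp.Msub ≤ LinearMap.ker C.dtilde := by
    refine iSup_le fun i => ?_
    rintro _ ⟨w, rfl⟩
    exact sp.dtilde_piM hbd i.1 i.2 w
  exact this hv

include sp in
theorem dtilde_sq : C.dtilde ∘ₗ C.dtilde = 0 := by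
  refine sp.hom_ext (fun n p v => ?_) (fun n p v => ?_) (fun n p v => ?_)
  · simp [sp.dtilde_piM hbd]
  · simp [sp.dtilde_piB hbd]
  · obtain ⟨w, hw⟩ := sp.tcomp_piK_mem n p v
    simp [sp.dtilde_piK hbd, ← hw, sp.dtilde_piB hbd]

theorem projM_dtilde (v : V) : sp.projM (C.dtilde v) = 0 := by
  suffices sp.projM ∘ₗ C.dtilde = 0 from LinearMap.congr_fun this v
  refine sp.hom_ext (fun n p v => ?_) (fun n p v => ?_) (fun n p v => ?_)
  · simp [sp.dtilde_piM hbd]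
  · simp [sp.dtilde_piB hbd]
  · obtain ⟨w, hw⟩ := sp.tcomp_piK_mem n p v
    simp [sp.dtilde_piK hbd, ← hw, sp.projM_piB hbd]

end Bounded

namespace IsHTilde

variable {sp} {ht : V →ₗ[k] V} (hht : sp.IsHTilde ht)
include hht

theorem apply_piM (n : ℤ) (p : P) (v : V) : ht (sp.piM n p v) = 0 :=
  LinearMap.congr_fun (hht.1 n p) v

theorem apply_piK (n : ℤ) (p : P) (v : V) : ht (sp.piK n p v) = 0 :=
  LinearMap.congr_fun (hht.2.1 n p) v

theorem exists_piK (n : ℤ) (p : P) (v : V) :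
    ∃ w, ht (sp.piB n p v) = sp.piK (n + 1) p w := by
  obtain ⟨w, hw⟩ := (hht.2.2 n p _ (mem_range_self _ v)).1
  exact ⟨w, hw.symm⟩

theorem apply_of_mem {v : V} (hv : v ∈ sp.Msub) : ht v = 0 := by
  have : sp.Msub ≤ LinearMap.ker ht := by
    refine iSup_le fun i => ?_
    rintro _ ⟨w, rfl⟩
    exact hht.apply_piM i.1 i.2 w
  exact this hv

theorem apply_apply (v : V) : ht (ht v) = 0 := by
  suffices ht ∘ₗ ht = 0 from LinearMap.congr_fun this v
  refine sp.hom_ext (fun n p v => ?_) (fun n p v => ?_) (fun n p v => ?_)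
  · simp [hht.apply_piM]
  · obtain ⟨w, hw⟩ := hht.exists_piK n p v
    simp [hw, hht.apply_piK]
  · simp [hht.apply_piK]

theorem pFilt : PFilt C.gr C.gr ht := by
  intro n m p q hpq
  ext v
  obtain ⟨w, hw⟩ := hht.exists_piK n q v
  simp only [comp_apply, ← sp.sum_eq n q, LinearMap.add_apply, map_add, hht.apply_piM,
    hht.apply_piK, hw, zero_add, add_zero, LinearMap.zero_apply]
  rw [← sp.proj_comp_piK]
  exact LinearMap.congr_fun (C.gr.proj_orth (m, p) (n + 1, q) fun h =>
    hpq (congrArg Prod.snd h).le) _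

variable (hbd : C.Bounded)
include hbd

theorem projM_apply (v : V) : sp.projM (ht v) = 0 := by
  suffices sp.projM ∘ₗ ht = 0 from LinearMap.congr_fun this v
  refine sp.hom_ext (fun n p v => ?_) (fun n p v => ?_) (fun n p v => ?_)
  · simp [hht.apply_piM]
  · obtain ⟨w, hw⟩ := hht.exists_piK n p v
    simp [hw, sp.projM_piK hbd]
  · simp [hht.apply_piK]

theorem dtilde_apply_piB (n : ℤ) (p : P) (v : V) :
    C.dtilde (ht (sp.piB n p v)) = -sp.piB n p v := by
  obtain ⟨w, hw⟩ := hht.exists_piK n p v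
  rw [hw, sp.dtilde_piK hbd, ← hw]
  exact (hht.2.2 n p _ (mem_range_self _ v)).2

theorem apply_dtilde_piK (n : ℤ) (p : P) (v : V) :
    ht (C.dtilde (sp.piK n p v)) = -sp.piK n p v := by
  obtain ⟨u, hu⟩ := sp.tcomp_piK_mem n p v
  rw [sp.dtilde_piK hbd, ← hu]
  have h := hht.2.2 (n - 1) p _ (mem_range_self _ u)
  rw [sub_add_cancel, hu] at h
  rw [hu, ← add_eq_zero_iff_eq_neg]
  exact sp.K_inj n p _ (add_mem h.1 (mem_range_self _ v)) (by rw [map_add, h.2, neg_add_cancel])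

theorem projM_eq : sp.projM = LinearMap.id + C.dtilde ∘ₗ ht + ht ∘ₗ C.dtilde := by
  refine sp.hom_ext (fun n p v => ?_) (fun n p v => ?_) (fun n p v => ?_)
  · simp [sp.projM_piM hbd, hht.apply_piM, sp.dtilde_piM hbd]
  · simp [sp.projM_piB hbd, hht.dtilde_apply_piB hbd, sp.dtilde_piB hbd]
  · simp [sp.projM_piK hbd, hht.apply_dtilde_piK hbd, hht.apply_piK]

/-- The unperturbed contraction from `(C, d̃)` onto `(M, 0)`. -/
theorem isContraction :
    IsContraction C.dtilde 0 (sp.projM.codRestrict sp.Msub (sp.projM_mem hbd))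
      sp.Msub.subtype ht where
  f_chain := by ext v; exact sp.projM_dtilde hbd v
  g_chain := by ext v; exact (sp.dtilde_of_mem hbd v.2).symm
  fg := by ext v; exact sp.projM_of_mem hbd v.2
  gf := hht.projM_eq hbd
  fh := by ext v; exact hht.projM_apply hbd v
  hg := by ext v; exact hht.apply_of_mem v.2
  hh := by ext v; exact hht.apply_apply v

end IsHTilde

end ConsSplit

/-- Let `(C, d)` be a bounded `P`-graded chain complex of
finite-dimensional vector spaces with a consistent splitting, and let
`f̃ = j_M`, `g̃ = i_M`, `h̃ = -i_K ∘ (⊕_p (t^p|_{K^p})^{-1}) ∘ j_B`,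
`δ = Σ_{p<q} t^{pq}` and `S = Σ_{n ≥ 0} δ (h̃δ)^n`.  Then, with `d^M = f̃Sg̃`,
the triple `(f, g, h)` given by `f = f̃ + f̃Sh̃`, `g = g̃ + h̃Sg̃`,
`h = h̃ + h̃Sh̃` is a `P`-filtered contraction from `(C, d)` onto `(M, d^M)`. -/
theorem stmt4 {k V P : Type*} [Field k] [AddCommGroup V] [Module k V]
    [PartialOrder P] [Fintype P]
    (C : PCC k V P) (hbd : C.Bounded) [FiniteDimensional k V]
    (sp : ConsSplit C)
    (ht : V →ₗ[k] V) (hht : sp.IsHTilde ht)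
    (S : V →ₗ[k] V) (hS : IsPerturbSum C.delta ht S) :
    ∃ (f : V →ₗ[k] ↥sp.Msub) (dM : ↥sp.Msub →ₗ[k] ↥sp.Msub),
      -- `f = f̃ + f̃Sh̃`  (where `f̃` is the corestriction of `j_M`)
      sp.Msub.subtype ∘ₗ f = sp.projM + sp.projM ∘ₗ (S ∘ₗ ht) ∧
      -- `d^M = f̃Sg̃`  (where `g̃ = i_M` is the inclusion)
      sp.Msub.subtype ∘ₗ dM = sp.projM ∘ₗ (S ∘ₗ sp.Msub.subtype) ∧
      -- `(f, g, h)` with `g = g̃ + h̃Sg̃`, `h = h̃ + h̃Sh̃` is a contraction: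
      IsContraction C.d dM f
        (sp.Msub.subtype + ht ∘ₗ (S ∘ₗ sp.Msub.subtype))
        (ht + ht ∘ₗ (S ∘ₗ ht)) ∧
      -- the contraction is `P`-filtered:
      PFilt C.gr C.gr (sp.Msub.subtype ∘ₗ f) ∧
      (∀ (n : ℤ) (q : P) (v : ↥sp.Msub), (v : V) ∈ LinearMap.range (sp.piM n q) →
        ∀ (m : ℤ) (p : P), ¬ p ≤ q →
          C.gr.proj (m, p) ((sp.Msub.subtype + ht ∘ₗ (S ∘ₗ sp.Msub.subtype)) v) = 0) ∧
      PFilt C.gr C.gr (ht + ht ∘ₗ (S ∘ₗ ht)) := by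
  have hd : C.dtilde + C.delta = C.d := add_sub_cancel _ _
  have hcon := (hht.isContraction hbd).perturb (δ := C.delta) (sp.dtilde_sq hbd)
    (by rw [hd]; exact C.d_sq) hS
  rw [hd] at hcon
  have hdel : PFilt C.gr C.gr C.delta := by
    rw [pFilt_iff_below]
    exact fun q v hv => sub_mem (pFilt_iff_below.1 C.pFilt_d q v hv)
      (pFilt_iff_below.1 (PCC.pFilt_dtilde hbd) q v hv)
  rw [pFilt_iff_below] at hdel
  have hh := pFilt_iff_below.1 hht.pFilt
  have hM := pFilt_iff_below.1 (sp.pFilt_projM hbd)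
  have hSf : ∀ q, ∀ v ∈ C.gr.below q, S v ∈ C.gr.below q := fun q =>
    hS.mem_of_mem (hdel q) (hh q)
  refine ⟨_, _, rfl, rfl, hcon, ?_, ?_, ?_⟩
  · rw [pFilt_iff_below]
    exact fun q v hv => add_mem (hM q v hv) (hM q _ (hSf q _ (hh q v hv)))
  · rintro n q v ⟨w, hw⟩ m p hpq
    have hv : (v : V) ∈ C.gr.below q := by
      rw [← hw, ← sp.proj_comp_piM]
      exact C.gr.proj_mem_below n q _
    exact VGrading.mem_below.1 (add_mem hv (hh q _ (hSf q _ hv))) (m, p) hpq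
  · rw [pFilt_iff_below]
    exact fun q v hv => add_mem (hh q v hv) (hh q _ (hSf q _ (hh q v hv)))
end
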